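/- arXiv:2406.09996 — 6 statements merged into one kernel-verified Lean document; each statement's English description precedes it below -/
import Mathlib

section
/- Let n ≥ 1 and let ω : ℝⁿ → ℝ be a measurable function, positive almost everywhere, satisfying the A₂ condition with constant C. Then μ_ω satisfies a reverse doubling condition: there exist a constant C' > 0 and an exponent q ∈ (0,1), depending only on n and C, such that for every metric ball B ⊆ ℝⁿ of positive radius and every measurable E ⊆ B, μ_ω(E) ≤ C' · (vol(E)/vol(B))^q · μ_ω(B). -/
open MeasureTheory Metric NNReal ENNReal

/-- `ω` satisfies the Muckenhoupt `A₂` condition with constant `C` on `ℝⁿ`: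
for every metric ball `B` of positive radius,
`(⨍_B ω) · (⨍_B ω⁻¹) ≤ C`, stated equivalently (multiplying through by `vol(B)²`)
as `(∫_B ω) · (∫_B ω⁻¹) ≤ C · vol(B)²`, with integrals in `[0,∞]`. -/
def IsA2 (n : ℕ) (ω : EuclideanSpace ℝ (Fin n) → ℝ) (C : ℝ≥0∞) : Prop :=
  ∀ (x : EuclideanSpace ℝ (Fin n)) (r : ℝ), 0 < r →
    (∫⁻ y in ball x r, ENNReal.ofReal (ω y)) *
      (∫⁻ y in ball x r, ENNReal.ofReal (ω y)⁻¹) ≤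
      C * (volume (ball x r)) ^ 2

/-- The measure `μ_ω` with density `ω` with respect to Lebesgue measure. -/
noncomputable def muOmega (n : ℕ) (ω : EuclideanSpace ℝ (Fin n) → ℝ) :
    Measure (EuclideanSpace ℝ (Fin n)) :=
  volume.withDensity (fun x => ENNReal.ofReal (ω x))

open Set Filter Topology Module

/-- **Cauchy–Schwarz** for a weight and its inverse. -/
theorem sq_measure_le_lintegral_mul_lintegral_inv {α : Type*} [MeasurableSpace α]
    (μ : Measure α) {w : α → ℝ≥0∞} (hw : Measurable w)
    (h0 : ∀ᵐ x ∂μ, w x ≠ 0) (ht : ∀ᵐ x ∂μ, w x ≠ ∞) :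
    μ univ ^ 2 ≤ (∫⁻ x, w x ∂μ) * ∫⁻ x, (w x)⁻¹ ∂μ := by
  have key := ENNReal.lintegral_mul_le_Lp_mul_Lq μ Real.HolderConjugate.two_two
    (f := fun x => w x ^ (1 / 2 : ℝ)) (g := fun x => (w x)⁻¹ ^ (1 / 2 : ℝ))
    (hw.pow_const _).aemeasurable (hw.inv.pow_const _).aemeasurable
  have h1 : ∫⁻ x, ((fun x => w x ^ (1 / 2 : ℝ)) * fun x => (w x)⁻¹ ^ (1 / 2 : ℝ)) x ∂μ
      = μ univ := by
    rw [← lintegral_one]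
    refine lintegral_congr_ae ?_
    filter_upwards [h0, ht] with x hx0 hxt
    simp only [Pi.mul_apply]
    rw [← ENNReal.mul_rpow_of_nonneg _ _ (by norm_num), ENNReal.mul_inv_cancel hx0 hxt,
      ENNReal.one_rpow]
  have half (a : ℝ≥0∞) : (a ^ (1 / 2 : ℝ)) ^ (2 : ℝ) = a := by
    rw [← ENNReal.rpow_mul]; norm_num
  rw [h1] at key
  simp only [half] at key
  calc μ univ ^ 2
      ≤ ((∫⁻ x, w x ∂μ) ^ (1 / 2 : ℝ) * (∫⁻ x, (w x)⁻¹ ∂μ) ^ (1 / 2 : ℝ)) ^ 2 := by gcongr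
    _ = _ := by
      rw [mul_pow, ← ENNReal.rpow_two, ← ENNReal.rpow_two, half, half]

theorem ball_ae_eq_closedBall {E : Type*} [NormedAddCommGroup E] [NormedSpace ℝ E]
    [FiniteDimensional ℝ E] [MeasurableSpace E] [BorelSpace E] (μ : Measure E)
    [μ.IsAddHaarMeasure] (x : E) {r : ℝ} (hr : r ≠ 0) : ball x r =ᵐ[μ] closedBall x r := by
  rw [← ball_union_sphere]
  exact (union_ae_eq_left_of_ae_eq_empty
    (ae_eq_empty.2 (Measure.addHaar_sphere_of_ne_zero μ x hr))).symm

theorem IsA2.sq_volume_mul_muOmega_closedBall_le {n : ℕ} {ω : EuclideanSpace ℝ (Fin n) → ℝ}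
    {C : ℝ≥0∞} (hA : IsA2 n ω C) (hω : Measurable ω)
    (hpos : ∀ᵐ x ∂(volume : Measure (EuclideanSpace ℝ (Fin n))), 0 < ω x)
    (x : EuclideanSpace ℝ (Fin n)) {r : ℝ} (hr : 0 < r) {F : Set (EuclideanSpace ℝ (Fin n))}
    (hF : MeasurableSet F) (hFB : F ⊆ closedBall x r) :
    volume F ^ 2 * muOmega n ω (closedBall x r) ≤
      C * volume (closedBall x r) ^ 2 * muOmega n ω F := by
  have hae := ball_ae_eq_closedBall (volume : Measure (EuclideanSpace ℝ (Fin n))) x hr.ne'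
  have hB := hA x r hr
  rw [measure_congr hae, Measure.restrict_congr_set hae] at hB
  have hmB : muOmega n ω (closedBall x r) = ∫⁻ y in closedBall x r, ENNReal.ofReal (ω y) :=
    withDensity_apply _ measurableSet_closedBall
  have hmF : muOmega n ω F = ∫⁻ y in F, ENNReal.ofReal (ω y) := withDensity_apply _ hF
  have hCS := sq_measure_le_lintegral_mul_lintegral_inv (volume.restrict F)
    hω.ennreal_ofReal
    (ae_restrict_of_ae (hpos.mono fun y hy => (ENNReal.ofReal_pos.2 hy).ne'))
    (Eventually.of_forall fun _ => ENNReal.ofReal_ne_top)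
  have hinv : ∫⁻ y in F, (ENNReal.ofReal (ω y))⁻¹ = ∫⁻ y in F, ENNReal.ofReal (ω y)⁻¹ :=
    lintegral_congr_ae
      (ae_restrict_of_ae (hpos.mono fun y hy => (ENNReal.ofReal_inv_of_pos hy).symm))
  rw [Measure.restrict_apply_univ, hinv] at hCS
  rw [hmB, hmF]
  calc _ ≤ ((∫⁻ y in F, ENNReal.ofReal (ω y)) *
          ∫⁻ y in closedBall x r, ENNReal.ofReal (ω y)⁻¹) *
          ∫⁻ y in closedBall x r, ENNReal.ofReal (ω y) := by
        gcongr
        exact hCS.trans (by gcongr)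
    _ = ((∫⁻ y in closedBall x r, ENNReal.ofReal (ω y)) *
          ∫⁻ y in closedBall x r, ENNReal.ofReal (ω y)⁻¹) *
          ∫⁻ y in F, ENNReal.ofReal (ω y) := by ring
    _ ≤ _ := by gcongr

/-- Almost every point of `S` lies in a sub-ball of the ambient ball in which the density of `S`
is at most one half, but bounded below. -/
theorem ae_exists_closedBall_density {E : Type*} [NormedAddCommGroup E] [NormedSpace ℝ E]
    [FiniteDimensional ℝ E] [MeasurableSpace E] [BorelSpace E] (μ : Measure E)
    [μ.IsAddHaarMeasure] (x₀ : E) {r : ℝ} (hr : 0 < r) {S : Set E} (hS : MeasurableSet S)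
    (hSB : S ⊆ closedBall x₀ r) (hhalf : 2 * μ S ≤ μ (closedBall x₀ r)) :
    ∀ᵐ x ∂μ, x ∈ S → ∃ c s, 0 < s ∧ s ≤ r ∧ x ∈ closedBall c s ∧
      closedBall c s ⊆ closedBall x₀ r ∧ 2 * μ (S ∩ closedBall c s) ≤ μ (closedBall c s) ∧
      μ (closedBall c s) ≤ 2 ^ (finrank ℝ E + 1) * μ (S ∩ closedBall c s) := by
  have hd := IsUnifLocDoublingMeasure.ae_tendsto_measure_inter_div μ S 1
  rw [ae_restrict_iff' hS] at hd
  filter_upwards [hd] with x hx hxS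
  set θ : ℕ → ℝ := fun k => (1 / 2) ^ k with hθ
  have hθ0 (k : ℕ) : 0 < θ k := by positivity
  have hθ1 (k : ℕ) : θ k ≤ 1 := pow_le_one₀ (by norm_num) (by norm_num)
  have hθs (k : ℕ) : θ k = 2 * θ (k + 1) := by simp only [hθ]; ring
  set c : ℕ → E := fun k => x + θ k • (x₀ - x) with hc
  have hxr : ‖x - x₀‖ ≤ r := by simpa [dist_eq_norm] using hSB hxS
  have hxr' : ‖x₀ - x‖ ≤ r := by rwa [norm_sub_rev]
  have hmem (k : ℕ) : x ∈ closedBall (c k) (θ k * r) := by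
    rw [mem_closedBall', dist_eq_norm]
    simp only [hc, add_sub_cancel_left, norm_smul, Real.norm_of_nonneg (hθ0 k).le]
    gcongr
  have hnest (k l : ℕ) (hlk : θ k ≤ θ l) :
      closedBall (c k) (θ k * r) ⊆ closedBall (c l) (θ l * r) := by
    refine closedBall_subset_closedBall' ?_
    have : c k - c l = -((θ l - θ k) • (x₀ - x)) := by simp only [hc]; module
    rw [dist_eq_norm, this, norm_neg, norm_smul, Real.norm_of_nonneg (by linarith)]
    nlinarith
  have hlim : Tendsto (fun k => θ k * r) atTop (𝓝[>] 0) := by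
    refine tendsto_nhdsWithin_iff.2 ⟨?_, Eventually.of_forall fun k => mul_pos (hθ0 k) hr⟩
    simpa [hθ] using (tendsto_pow_atTop_nhds_zero_of_lt_one (r := (1 / 2 : ℝ)) (by norm_num)
      (by norm_num)).mul_const r
  have hT := hx hxS c _ hlim (Eventually.of_forall fun k => by simpa using hmem k)
  have hBpos (k : ℕ) : μ (closedBall (c k) (θ k * r)) ≠ 0 :=
    (measure_closedBall_pos μ _ (mul_pos (hθ0 k) hr)).ne'
  have hBfin (k : ℕ) : μ (closedBall (c k) (θ k * r)) ≠ ∞ := measure_closedBall_lt_top.ne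
  have hex : ∃ k, μ (closedBall (c k) (θ k * r)) <
      2 * μ (S ∩ closedBall (c k) (θ k * r)) := by
    obtain ⟨k, hk⟩ := (hT.eventually (lt_mem_nhds (show (2 : ℝ≥0∞)⁻¹ < 1 by simp))).exists
    refine ⟨k, ?_⟩
    rw [ENNReal.lt_div_iff_mul_lt (Or.inl (hBpos k)) (Or.inl (hBfin k))] at hk
    rwa [mul_comm (2 : ℝ≥0∞)⁻¹, ← div_eq_mul_inv, ENNReal.div_lt_iff (by simp) (by simp),
      mul_comm _ (2 : ℝ≥0∞)] at hk
  classical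
  have hfind := Nat.find_spec hex
  have hmin := fun m => Nat.find_min (m := m) hex
  obtain hk | ⟨k, hk⟩ : Nat.find hex = 0 ∨ ∃ k, Nat.find hex = k + 1 := by
    cases Nat.find hex <;> simp
  · rw [hk] at hfind
    have h0 : closedBall (c 0) (θ 0 * r) = closedBall x₀ r := by simp [hc, hθ]
    rw [h0, inter_eq_self_of_subset_left hSB] at hfind
    exact absurd hhalf hfind.not_ge
  · rw [hk] at hfind
    refine ⟨c k, θ k * r, mul_pos (hθ0 k) hr, mul_le_of_le_one_left hr.le (hθ1 k), hmem k, ?_,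
      not_lt.1 (hmin k (by omega)), ?_⟩
    · have h0 : closedBall (c 0) (θ 0 * r) = closedBall x₀ r := by simp [hc, hθ]
      rw [← h0]
      exact hnest k 0 (by simpa [hθ] using hθ1 k)
    · have hvol : μ (closedBall (c k) (θ k * r)) =
          2 ^ finrank ℝ E * μ (closedBall (c (k + 1)) (θ (k + 1) * r)) := by
        rw [hθs, mul_assoc, Measure.addHaar_closedBall_mul μ _ zero_le_two
          (mul_pos (hθ0 _) hr).le, Measure.addHaar_closedBall_center μ (c (k + 1)),
          ENNReal.ofReal_pow zero_le_two, ENNReal.ofReal_ofNat]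
      rw [hvol, pow_succ, mul_assoc]
      gcongr
      refine hfind.le.trans ?_
      gcongr
      exact hnest _ _ (by linarith [hθs k, hθ0 (k + 1)])

section Growth

variable {n : ℕ} {ω : EuclideanSpace ℝ (Fin n) → ℝ} {C : ℝ≥0}

theorem IsA2.muOmega_closedBall_five_mul_le (hA : IsA2 n ω C) (hω : Measurable ω)
    (hpos : ∀ᵐ x ∂(volume : Measure (EuclideanSpace ℝ (Fin n))), 0 < ω x)
    {S : Set (EuclideanSpace ℝ (Fin n))} (hS : MeasurableSet S)
    {c : EuclideanSpace ℝ (Fin n)} {s : ℝ} (hs : 0 < s)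
    (hhalf : 2 * volume (S ∩ closedBall c s) ≤ volume (closedBall c s)) :
    muOmega n ω (closedBall c (5 * s)) ≤
      (C * 5 ^ (2 * n) * 4 : ℝ≥0) * muOmega n ω (closedBall c s \ S) := by
  set F := closedBall c s \ S
  have hFm : MeasurableSet F := measurableSet_closedBall.diff hS
  have hBfin : volume (closedBall c s) ≠ ∞ := measure_closedBall_lt_top.ne
  have hB0 : volume (closedBall c s) ≠ 0 := (measure_closedBall_pos volume _ hs).ne'
  have hsplit : volume (S ∩ closedBall c s) + volume F = volume (closedBall c s) := by
    rw [inter_comm]; exact measure_inter_add_sdiff _ hS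
  have hIfin : volume (S ∩ closedBall c s) ≠ ∞ :=
    ne_top_of_le_ne_top hBfin (measure_mono inter_subset_right)
  have hBF : volume (closedBall c s) ≤ 2 * volume F := by
    have h1 : volume (S ∩ closedBall c s) ≤ volume F := by
      rw [← hsplit, two_mul] at hhalf
      exact (ENNReal.add_le_add_iff_left hIfin).1 hhalf
    rw [← hsplit, two_mul]
    gcongr
  have hF0 : volume F ≠ 0 := fun h => hB0 (by simpa [h] using hBF)
  have hFfin : volume F ≠ ∞ := ne_top_of_le_ne_top hBfin (measure_mono sdiff_subset)
  have key := hA.sq_volume_mul_muOmega_closedBall_le hω hpos c (r := 5 * s) (by positivity) hFm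
    (sdiff_subset.trans (closedBall_subset_closedBall (by linarith)))
  have hvol : volume (closedBall c (5 * s)) = 5 ^ n * volume (closedBall c s) := by
    rw [Measure.addHaar_closedBall_mul volume _ (by norm_num) hs.le,
      Measure.addHaar_closedBall_center volume c, ENNReal.ofReal_pow (by norm_num),
      ENNReal.ofReal_ofNat, finrank_euclideanSpace_fin]
  refine (ENNReal.mul_le_mul_iff_right (pow_ne_zero 2 hF0) (ENNReal.pow_ne_top hFfin)).1 ?_
  calc _ ≤ _ := key
    _ ≤ C * (5 ^ n * (2 * volume F)) ^ 2 * muOmega n ω F := by rw [hvol]; gcongr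
    _ = _ := by push_cast; ring

/-- A set of small measure in a ball can be enlarged, increasing its Lebesgue measure at most by a
bounded factor and its weighted measure at least by a definite factor. -/
theorem IsA2.exists_superset_muOmega_le (hA : IsA2 n ω C) (hω : Measurable ω)
    (hpos : ∀ᵐ x ∂(volume : Measure (EuclideanSpace ℝ (Fin n))), 0 < ω x)
    {M : ℝ≥0} (hM0 : M ≠ 0) (hM : C * 5 ^ (2 * n) * 4 ≤ M)
    (x₀ : EuclideanSpace ℝ (Fin n)) {r : ℝ} (hr : 0 < r)
    {S : Set (EuclideanSpace ℝ (Fin n))} (hS : MeasurableSet S) (hSB : S ⊆ closedBall x₀ r)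
    (hhalf : 2 * volume S ≤ volume (closedBall x₀ r)) :
    ∃ T, MeasurableSet T ∧ T ⊆ closedBall x₀ r ∧
      volume T ≤ (1 + 2 ^ (n + 1)) * volume S ∧
      ((1 + M⁻¹ : ℝ≥0) : ℝ≥0∞) * muOmega n ω S ≤ muOmega n ω T := by
  set t : Set (EuclideanSpace ℝ (Fin n) × ℝ) := {p | 0 < p.2 ∧ p.2 ≤ r ∧
    closedBall p.1 p.2 ⊆ closedBall x₀ r ∧
    2 * volume (S ∩ closedBall p.1 p.2) ≤ volume (closedBall p.1 p.2) ∧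
    volume (closedBall p.1 p.2) ≤ 2 ^ (n + 1) * volume (S ∩ closedBall p.1 p.2)}
  obtain ⟨u, hut, hdisj, hcov⟩ := Vitali.exists_disjoint_subfamily_covering_enlargement_closedBall
    t Prod.fst Prod.snd r (fun p hp => hp.2.1) 5 (by norm_num)
  have hucount : u.Countable := hdisj.countable_of_nonempty_interior fun p hp =>
    ⟨p.1, ball_subset_interior_closedBall (mem_ball_self (hut hp).1)⟩
  have hac : muOmega n ω ≪ volume := withDensity_absolutelyContinuous _ _
  have hSle : muOmega n ω S ≤ muOmega n ω (⋃ p ∈ u, closedBall p.1 (5 * p.2)) := by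
    refine measure_mono_ae (hac.ae_le ?_)
    filter_upwards [ae_exists_closedBall_density volume x₀ hr hS hSB hhalf] with x hx hxS
    obtain ⟨c, s, hs, hsr, hxc, hsub, h1, h2⟩ := hx hxS
    rw [finrank_euclideanSpace_fin] at h2
    obtain ⟨p, hpu, hp⟩ := hcov (c, s) ⟨hs, hsr, hsub, h1, h2⟩
    exact mem_biUnion hpu (hp hxc)
  have hDm (p : EuclideanSpace ℝ (Fin n) × ℝ) : MeasurableSet (closedBall p.1 p.2 \ S) :=
    measurableSet_closedBall.diff hS
  set D := ⋃ p ∈ u, (closedBall p.1 p.2 \ S) with hD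
  have hSD : muOmega n ω S ≤ M * muOmega n ω D := by
    rw [hD, measure_biUnion hucount (fun p hp q hq hpq => (hdisj hp hq hpq).mono sdiff_subset
      sdiff_subset) fun p _ => hDm p, ← ENNReal.tsum_mul_left]
    refine hSle.trans ((measure_biUnion_le _ hucount _).trans ?_)
    refine ENNReal.tsum_le_tsum fun p => ?_
    have hp := hut p.2
    refine (hA.muOmega_closedBall_five_mul_le hω hpos hS hp.1 hp.2.2.2.1).trans ?_
    gcongr
  have hSDdisj : Disjoint S D := by
    rw [hD, disjoint_iUnion₂_right]
    exact fun p _ => disjoint_sdiff_right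
  refine ⟨S ∪ D, hS.union (.biUnion hucount fun p _ => hDm p),
    union_subset hSB (iUnion₂_subset fun p hp => sdiff_subset.trans (hut hp).2.2.1), ?_, ?_⟩
  · refine (measure_union_le _ _).trans ?_
    rw [add_mul, one_mul]
    gcongr
    calc volume D ≤ ∑' p : u, volume (closedBall p.1.1 p.1.2 \ S) :=
          measure_biUnion_le _ hucount _
      _ ≤ ∑' p : u, 2 ^ (n + 1) * volume (S ∩ closedBall p.1.1 p.1.2) :=
          ENNReal.tsum_le_tsum fun p => (measure_mono sdiff_subset).trans (hut p.2).2.2.2.2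
      _ = 2 ^ (n + 1) * volume (⋃ p ∈ u, S ∩ closedBall p.1 p.2) := by
          rw [ENNReal.tsum_mul_left, measure_biUnion hucount (fun p hp q hq hpq =>
            (hdisj hp hq hpq).mono inter_subset_right inter_subset_right)
            fun p _ => hS.inter measurableSet_closedBall]
      _ ≤ _ := by
          gcongr
          exact iUnion₂_subset fun p _ => inter_subset_left
  · rw [measure_union' hSDdisj hS]
    push_cast
    rw [add_mul, one_mul]
    gcongr
    calc (M⁻¹ : ℝ≥0) * muOmega n ω S ≤ (M⁻¹ : ℝ≥0) * (M * muOmega n ω D) := by gcongr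
      _ = _ := by
        rw [← mul_assoc, ← ENNReal.coe_mul, inv_mul_cancel₀ hM0, ENNReal.coe_one, one_mul]

theorem IsA2.pow_mul_muOmega_le (hA : IsA2 n ω C) (hω : Measurable ω)
    (hpos : ∀ᵐ x ∂(volume : Measure (EuclideanSpace ℝ (Fin n))), 0 < ω x)
    {M : ℝ≥0} (hM0 : M ≠ 0) (hM : C * 5 ^ (2 * n) * 4 ≤ M)
    (x₀ : EuclideanSpace ℝ (Fin n)) {r : ℝ} (hr : 0 < r) (m : ℕ) :
    ∀ {S : Set (EuclideanSpace ℝ (Fin n))}, MeasurableSet S → S ⊆ closedBall x₀ r →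
      m = 0 ∨ 2 * (1 + 2 ^ (n + 1)) ^ m * volume S ≤ volume (closedBall x₀ r) →
      ((1 + M⁻¹ : ℝ≥0) : ℝ≥0∞) ^ m * muOmega n ω S ≤ muOmega n ω (closedBall x₀ r) := by
  induction m with
  | zero => intro S _ hSB _; simpa using measure_mono hSB
  | succ m ih =>
    intro S hS hSB h
    replace h := h.resolve_left (by simp)
    obtain ⟨T, hT, hTB, hTS, hST⟩ := hA.exists_superset_muOmega_le hω hpos hM0 hM x₀ hr hS hSB
      (h.trans' <| by
        gcongr
        exact le_mul_of_one_le_right' (one_le_pow₀ le_self_add))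
    rw [pow_succ, mul_assoc]
    refine le_trans (by gcongr) (ih hT hTB (Or.inr (h.trans' ?_)))
    calc _ ≤ 2 * (1 + 2 ^ (n + 1)) ^ m * ((1 + 2 ^ (n + 1)) * volume S) := by gcongr
      _ = _ := by ring

end Growth

/-- Geometric decay along a geometric sequence of scales is power decay. -/
theorem exists_rpow_exponent {b K : ℝ} (hb : 1 < b) (hK : 1 < K) :
    ∃ q : ℝ, 0 < q ∧ q < 1 ∧ ∀ t : ℝ, 0 < t → t ≤ 1 →
      ∃ m : ℕ, (m = 0 ∨ 2 * K ^ m * t ≤ 1) ∧ 1 ≤ b ^ m * (2 * K * t ^ q) := by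
  have hlb := Real.log_pos hb
  have hlK := Real.log_pos hK
  have hK0 : 0 < K := by linarith
  refine ⟨min (1 / 2) (Real.log b / Real.log K), by positivity,
    (min_le_left _ _).trans_lt (by norm_num), ?_⟩
  set q := min (1 / 2) (Real.log b / Real.log K)
  have hq0 : 0 < q := by positivity
  have hq1 : q ≤ 1 := (min_le_left _ _).trans (by norm_num)
  have hKb : K ^ q ≤ b := by
    rw [← Real.log_le_log_iff (by positivity) (by linarith), Real.log_rpow hK0]
    exact (le_div_iff₀ hlK).1 (min_le_right _ _)
  have hstep (y : ℝ) (hy : 1 / (2 * K) ≤ y) : 1 ≤ 2 * K * y ^ q := by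
    have h1 : 1 / (2 * K) ≤ (1 / (2 * K)) ^ q := by
      refine Real.self_le_rpow_of_le_one (by positivity) ?_ hq1
      rw [div_le_one (by positivity)]; linarith
    have h2 : (1 / (2 * K)) ^ q ≤ y ^ q := Real.rpow_le_rpow (by positivity) hy hq0.le
    have h3 := h1.trans h2
    rwa [div_le_iff₀' (by positivity)] at h3
  intro t ht ht1
  by_cases h : 2 * t ≤ 1
  · obtain ⟨m, hm1, hm2⟩ := exists_nat_pow_near (x := 1 / (2 * t)) (y := K)
      (by rw [le_div_iff₀ (by positivity)]; linarith) hK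
    rw [le_div_iff₀ (by positivity)] at hm1
    rw [div_lt_iff₀ (by positivity)] at hm2
    refine ⟨m, Or.inr (by linarith), ?_⟩
    have hy : 1 / (2 * K) ≤ K ^ m * t := by
      rw [div_le_iff₀ (by positivity)]
      calc (1 : ℝ) ≤ K ^ (m + 1) * (2 * t) := hm2.le
        _ = _ := by ring
    calc 1 ≤ 2 * K * (K ^ m * t) ^ q := hstep _ hy
      _ = (K ^ q) ^ m * (2 * K * t ^ q) := by
        rw [Real.mul_rpow (by positivity) ht.le, ← Real.rpow_natCast, ← Real.rpow_natCast,
          ← Real.rpow_mul hK0.le, ← Real.rpow_mul hK0.le, mul_comm (m : ℝ) q]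
        ring
      _ ≤ _ := by gcongr
  · refine ⟨0, Or.inl rfl, ?_⟩
    rw [pow_zero, one_mul]
    refine hstep t ?_
    rw [div_le_iff₀ (by positivity)]
    nlinarith

/-- Reverse doubling for `A₂` weights: there are `C' > 0` and `q ∈ (0,1)`, depending
only on `n` and `C`, so that for every `A₂` weight `ω` with constant `C`, every ball `B`
of positive radius and every measurable `E ⊆ B`,
`μ_ω(E) ≤ C' · (vol(E)/vol(B))^q · μ_ω(B)`. -/
theorem statement2 (n : ℕ) (hn : 1 ≤ n) (C : ℝ≥0) :
    ∃ (C' : ℝ≥0∞) (q : ℝ), 0 < C' ∧ C' ≠ ∞ ∧ 0 < q ∧ q < 1 ∧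
      ∀ ω : EuclideanSpace ℝ (Fin n) → ℝ, Measurable ω →
        (∀ᵐ x ∂(volume : Measure (EuclideanSpace ℝ (Fin n))), 0 < ω x) →
        IsA2 n ω (C : ℝ≥0∞) →
        ∀ (x : EuclideanSpace ℝ (Fin n)) (r : ℝ), 0 < r →
          ∀ E : Set (EuclideanSpace ℝ (Fin n)), MeasurableSet E → E ⊆ ball x r →
            muOmega n ω E ≤
              C' * (volume E / volume (ball x r)) ^ q * muOmega n ω (ball x r) := by
  set M : ℝ≥0 := C * 5 ^ (2 * n) * 4 + 1
  have hM0 : M ≠ 0 := by positivity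
  have hM : C * 5 ^ (2 * n) * 4 ≤ M := le_self_add
  obtain ⟨q, hq0, hq1, hq⟩ := exists_rpow_exponent (b := ((1 + M⁻¹ : ℝ≥0) : ℝ))
    (K := 1 + 2 ^ (n + 1))
    (by
      have : (0 : ℝ) < M := by positivity
      push_cast
      linarith [inv_pos.2 this])
    (by linarith [show (0 : ℝ) < 2 ^ (n + 1) by positivity])
  refine ⟨2 * (1 + 2 ^ (n + 1)), q, by positivity, by finiteness, hq0, hq1, ?_⟩
  intro ω hω hpos hA x r hr S hS hSB
  have hae := ball_ae_eq_closedBall (volume : Measure (EuclideanSpace ℝ (Fin n))) x hr.ne'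
  have hac : muOmega n ω ≪ volume := withDensity_absolutelyContinuous _ _
  have hB0 : volume (ball x r) ≠ 0 := (measure_ball_pos volume x hr).ne'
  have hBfin : volume (ball x r) ≠ ∞ := measure_ball_lt_top.ne
  by_cases hS0 : volume S = 0
  · simp [hac hS0]
  have hτ1 : volume S / volume (ball x r) ≤ 1 := ENNReal.div_le_of_le_mul (by
    simpa using measure_mono hSB)
  set τ := volume S / volume (ball x r) with hτ
  have hτ0 : τ ≠ 0 := ENNReal.div_ne_zero.2 ⟨hS0, hBfin⟩
  lift τ to ℝ≥0 using ne_top_of_le_ne_top ENNReal.one_ne_top hτ1 with t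
  have ht0 : 0 < t := pos_iff_ne_zero.2 (by exact_mod_cast hτ0)
  have hSt : volume S = t * volume (ball x r) := by
    rw [hτ, ENNReal.div_mul_cancel hB0 hBfin]
  obtain ⟨m, hm, h1⟩ := hq t ht0 (by exact_mod_cast hτ1)
  have h1' : (1 : ℝ≥0∞) ≤ ((1 + M⁻¹ : ℝ≥0) : ℝ≥0∞) ^ m *
      (2 * (1 + 2 ^ (n + 1)) * (t : ℝ≥0∞) ^ q) := by
    rw [← ENNReal.coe_rpow_of_nonneg _ hq0.le]
    exact_mod_cast h1
  have h2 := hA.pow_mul_muOmega_le hω hpos hM0 hM x hr m hS (hSB.trans ball_subset_closedBall)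
    (hm.imp_right fun h => by
      have h' : (2 : ℝ≥0∞) * (1 + 2 ^ (n + 1)) ^ m * t ≤ 1 := by exact_mod_cast h
      rw [← measure_congr hae, hSt, ← mul_assoc]
      exact mul_le_of_le_one_left' h')
  rw [← measure_congr (hac.ae_eq hae)] at h2
  calc muOmega n ω S
      ≤ (((1 + M⁻¹ : ℝ≥0) : ℝ≥0∞) ^ m * (2 * (1 + 2 ^ (n + 1)) * (t : ℝ≥0∞) ^ q)) *
          muOmega n ω S := le_mul_of_one_le_left' h1'
    _ = 2 * (1 + 2 ^ (n + 1)) * (t : ℝ≥0∞) ^ q *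
          (((1 + M⁻¹ : ℝ≥0) : ℝ≥0∞) ^ m * muOmega n ω S) := by ring
    _ ≤ _ := by gcongr
end

section
/- Let n ≥ 1 and let ω : ℝⁿ → ℝ be a measurable function, positive almost everywhere, satisfying the A₂ condition with constant C. Then ω satisfies a reverse Hölder inequality: there exist an exponent r > 1 and a constant C' > 0, depending only on n and C, such that for every metric ball B ⊆ ℝⁿ of positive radius, (⨍_B ω^r dvol)^{1/r} ≤ C' · ⨍_B ω dvol. -/
open MeasureTheory Metric NNReal ENNReal

theorem Real.log_le_sub_one_sub_sq {u N : ℝ} (hu : 0 < u) (huN : u ≤ N) :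
    Real.log u ≤ (u - 1) - (u - 1) ^ 2 / (2 * (N + 1)) := by
  obtain ⟨w, hw, rfl⟩ : ∃ w : ℝ, 0 < w ∧ w ^ 2 = u :=
    ⟨√u, Real.sqrt_pos.2 hu, Real.sq_sqrt hu.le⟩
  have h1 : Real.log (w ^ 2) ≤ 2 * (w - 1) := by
    rw [Real.log_pow]; push_cast
    linarith [Real.log_le_sub_one_of_pos hw]
  have h2 : (w ^ 2 - 1) ^ 2 / (2 * (N + 1)) ≤ (w - 1) ^ 2 := by
    rw [div_le_iff₀ (by nlinarith)]
    have : (w ^ 2 - 1) ^ 2 = (w - 1) ^ 2 * (w + 1) ^ 2 := by ring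
    rw [this]
    gcongr
    nlinarith [sq_nonneg (w - 1)]
  nlinarith

/-- The Bellman function for the reverse Hölder inequality. -/
noncomputable def a2Bellman (ε x y : ℝ) : ℝ := x ^ (1 + ε) * (2 - ((x * y) ^ 2)⁻¹)

theorem a2Bellman_tangent {ε q u v N : ℝ} (hε : 0 ≤ ε) (hε' : ε ≤ 1 / 2) (hq : 0 ≤ q)
    (hεq : ε * (8 * (N + 1)) ≤ q) (hu : 0 < u) (huN : u ≤ N) (hv : 0 < v) :
    u ^ (1 + ε) * (2 - q * ((u * v) ^ 2)⁻¹) ≤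
      2 - q + (2 * (1 + ε) + (1 - ε) * q) * (u - 1) + 2 * q * (v - 1) := by
  have hN : 0 < N + 1 := by linarith
  have h1 : u ^ (1 + ε) ≤ u * (1 + ε * (u - 1)) := by
    rw [Real.rpow_add hu, Real.rpow_one]
    gcongr
    have := rpow_one_add_le_one_add_mul_self (s := u - 1) (by linarith) hε (by linarith)
    simpa using this
  have h2 : 1 + (1 - ε) * (-(u - 1) + (u - 1) ^ 2 / (2 * (N + 1))) - 2 * (v - 1) ≤
      u ^ (1 + ε) * ((u * v) ^ 2)⁻¹ := by
    have e : u ^ (1 + ε) * ((u * v) ^ 2)⁻¹ =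
        Real.exp (-(1 - ε) * Real.log u - 2 * Real.log v) := by
      rw [Real.rpow_def_of_pos hu, ← Real.exp_log (show 0 < ((u * v) ^ 2)⁻¹ by positivity),
        ← Real.exp_add, Real.log_inv, Real.log_pow, Real.log_mul hu.ne' hv.ne']
      congr 1; push_cast; ring
    rw [e]
    refine le_trans ?_ (Real.add_one_le_exp _)
    have := Real.log_le_sub_one_sub_sq hu huN
    have := Real.log_le_sub_one_of_pos hv
    nlinarith
  have h3 : 2 * (ε * (u - 1) ^ 2) ≤ q * ((1 - ε) * ((u - 1) ^ 2 / (2 * (N + 1)))) := by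
    have : ε * 2 ≤ q * ((1 - ε) / (2 * (N + 1))) := by
      rw [mul_div_assoc', le_div_iff₀ (by positivity)]
      nlinarith
    calc _ = (ε * 2) * (u - 1) ^ 2 := by ring
      _ ≤ _ := mul_le_mul_of_nonneg_right this (sq_nonneg _)
      _ = _ := by ring
  nlinarith [mul_le_mul_of_nonneg_left h2 hq]

theorem sum_a2Bellman_le {ι : Type*} [Fintype ι] {ε K x y : ℝ} {X Y : ι → ℝ}
    (hε : 0 ≤ ε) (hε' : ε ≤ 1 / 2)
    (hεK : ε * (8 * (Fintype.card ι + 1)) ≤ (K ^ 2)⁻¹)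
    (hx : 0 < x) (hy : 0 < y) (hxy : x * y ≤ K) (hX : ∀ i, 0 < X i) (hY : ∀ i, 0 < Y i)
    (hXx : ∑ i, X i = Fintype.card ι * x) (hYy : ∑ i, Y i = Fintype.card ι * y) :
    ∑ i, a2Bellman ε (X i) (Y i) ≤ Fintype.card ι * a2Bellman ε x y := by
  set q := ((x * y) ^ 2)⁻¹ with hq
  have hKq : (K ^ 2)⁻¹ ≤ q := by rw [hq]; gcongr
  have key : ∀ i, a2Bellman ε (X i) (Y i) ≤ x ^ (1 + ε) * (2 - q +
      (2 * (1 + ε) + (1 - ε) * q) * (X i / x - 1) + 2 * q * (Y i / y - 1)) := fun i ↦ by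
    have hle : X i / x ≤ Fintype.card ι := by
      rw [div_le_iff₀ hx, ← hXx]
      exact Finset.single_le_sum (fun j _ ↦ (hX j).le) (Finset.mem_univ i)
    have ht := a2Bellman_tangent (q := q) hε hε' (by positivity) (hεK.trans hKq)
      (div_pos (hX i) hx) hle (div_pos (hY i) hy)
    have hB : a2Bellman ε (X i) (Y i) = x ^ (1 + ε) * ((X i / x) ^ (1 + ε) *
        (2 - q * ((X i / x * (Y i / y)) ^ 2)⁻¹)) := by
      rw [a2Bellman, Real.div_rpow (hX i).le hx.le, hq, ← mul_assoc,
        mul_div_cancel₀ _ (Real.rpow_pos_of_pos hx _).ne']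
      have := (hX i).ne'
      have := (hY i).ne'
      congr 2
      field_simp
    rw [hB]
    gcongr
  calc _ ≤ _ := Finset.sum_le_sum fun i _ ↦ key i
    _ = _ := by
      rw [← Finset.mul_sum]
      simp only [Finset.sum_add_distrib, ← Finset.mul_sum, Finset.sum_sub_distrib,
        ← Finset.sum_div, hXx, hYy, a2Bellman, ← hq]
      simp [hx.ne', hy.ne']
      ring

/-- The half-open cube with lower corner `a` and side length `l`. -/
def halfOpenCube {ι : Type*} (a : ι → ℝ) (l : ℝ) : Set (ι → ℝ) :=
  Set.univ.pi fun i ↦ Set.Ico (a i) (a i + l)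

/-- The lower corner of a dyadic child of `halfOpenCube a l`. -/
noncomputable def childCorner {ι : Type*} (a : ι → ℝ) (l : ℝ) (e : ι → Bool) : ι → ℝ :=
  fun i ↦ a i + if e i then l / 2 else 0

/-- The average of `f` over `halfOpenCube a l`. -/
noncomputable def cubeAverage {ι : Type*} [Fintype ι] (f : (ι → ℝ) → ℝ) (a : ι → ℝ) (l : ℝ) : ℝ :=
  (∫ y in halfOpenCube a l, f y) / l ^ Fintype.card ι

section Cube

variable {ι : Type*}

theorem mem_halfOpenCube {a : ι → ℝ} {l : ℝ} {y : ι → ℝ} :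
    y ∈ halfOpenCube a l ↔ ∀ i, a i ≤ y i ∧ y i < a i + l := by
  simp [halfOpenCube]

theorem iUnion_halfOpenCube_childCorner (a : ι → ℝ) {l : ℝ} (hl : 0 < l) :
    ⋃ e, halfOpenCube (childCorner a l e) (l / 2) = halfOpenCube a l := by
  ext y
  simp only [Set.mem_iUnion, mem_halfOpenCube, childCorner]
  constructor
  · rintro ⟨e, he⟩ i
    have := he i
    split_ifs at this <;> constructor <;> linarith
  · intro h
    classical
    refine ⟨fun i ↦ decide (a i + l / 2 ≤ y i), fun i ↦ ?_⟩
    have := h i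
    by_cases h' : a i + l / 2 ≤ y i <;> simp [h'] <;> first | linarith | constructor <;> linarith

theorem pairwise_disjoint_halfOpenCube_childCorner (a : ι → ℝ) (l : ℝ) :
    Pairwise (Function.onFun Disjoint fun e ↦ halfOpenCube (childCorner a l e) (l / 2)) := by
  intro e e' hne
  obtain ⟨i, hi⟩ := Function.ne_iff.1 hne
  refine Set.disjoint_left.2 fun y hy hy' ↦ ?_
  have h1 := mem_halfOpenCube.1 hy i
  have h2 := mem_halfOpenCube.1 hy' i
  simp only [childCorner] at h1 h2
  cases he : e i <;> cases he' : e' i <;> simp_all <;> linarith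

variable [Fintype ι]

theorem measurableSet_halfOpenCube (a : ι → ℝ) (l : ℝ) : MeasurableSet (halfOpenCube a l) :=
  MeasurableSet.univ_pi fun _ ↦ measurableSet_Ico

theorem volume_halfOpenCube (a : ι → ℝ) {l : ℝ} (hl : 0 ≤ l) :
    volume (halfOpenCube a l) = ENNReal.ofReal (l ^ Fintype.card ι) := by
  rw [halfOpenCube, Real.volume_pi_Ico]
  simp [ENNReal.ofReal_pow hl]

theorem halfOpenCube_ae_eq_closedBall (a : ι → ℝ) {l : ℝ} (hl : 0 ≤ l) :
    halfOpenCube a l =ᵐ[volume] closedBall (fun i ↦ a i + l / 2) (l / 2) := by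
  have : closedBall (fun i ↦ a i + l / 2) (l / 2) = Set.Icc a (fun i ↦ a i + l) := by
    rw [closedBall_pi _ (by positivity), ← Set.pi_univ_Icc]
    refine Set.pi_congr rfl fun i _ ↦ ?_
    rw [Real.closedBall_eq_Icc]
    congr 1 <;> ring
  rw [this]
  exact Measure.univ_pi_Ico_ae_eq_Icc

theorem halfOpenCube_subset_closedBall (a : ι → ℝ) {l : ℝ} (hl : 0 ≤ l) :
    halfOpenCube a l ⊆ closedBall (fun i ↦ a i + l / 2) (l / 2) := by
  intro y hy
  rw [mem_closedBall, dist_pi_le_iff (by positivity)]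
  intro i
  have := mem_halfOpenCube.1 hy i
  rw [Real.dist_eq, abs_le]
  constructor <;> linarith

theorem cubeAverage_eq_average (f : (ι → ℝ) → ℝ) (a : ι → ℝ) {l : ℝ} (hl : 0 ≤ l) :
    cubeAverage f a l = ⨍ y in closedBall (fun i ↦ a i + l / 2) (l / 2), f y := by
  rw [← setAverage_congr (halfOpenCube_ae_eq_closedBall a hl), setAverage_eq, measureReal_def,
    volume_halfOpenCube a hl, ENNReal.toReal_ofReal (by positivity), cubeAverage, smul_eq_mul,
    div_eq_inv_mul]

theorem cubeAverage_pos {f : (ι → ℝ) → ℝ} {a : ι → ℝ} {l : ℝ} (hl : 0 < l)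
    (hf : ∀ᵐ x, 0 < f x) (hfi : IntegrableOn f (halfOpenCube a l)) :
    0 < cubeAverage f a l := by
  refine div_pos ?_ (by positivity)
  rw [setIntegral_pos_iff_support_of_nonneg_ae
    (ae_restrict_of_ae (hf.mono fun x hx ↦ hx.le)) hfi]
  have h : (Function.support f ∩ halfOpenCube a l : Set (ι → ℝ)) =ᵐ[volume] halfOpenCube a l := by
    filter_upwards [hf] with x hx
    have : x ∈ Function.support f := hx.ne'
    exact propext (and_iff_right this)
  rw [measure_congr h, volume_halfOpenCube a hl.le]
  simp only [ENNReal.ofReal_pos]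
  positivity

theorem one_le_cubeAverage_mul_cubeAverage_inv {f : (ι → ℝ) → ℝ} {a : ι → ℝ} {l : ℝ} (hl : 0 < l)
    (hf : ∀ᵐ x, 0 < f x) (hfi : IntegrableOn f (halfOpenCube a l))
    (hgi : IntegrableOn (fun x ↦ (f x)⁻¹) (halfOpenCube a l)) :
    1 ≤ cubeAverage f a l * cubeAverage (fun x ↦ (f x)⁻¹) a l := by
  set X := cubeAverage f a l with hX
  set Y := cubeAverage (fun x ↦ (f x)⁻¹) a l with hY
  have hXpos : 0 < X := cubeAverage_pos hl hf hfi
  have hln : 0 < l ^ Fintype.card ι := by positivity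
  have h : ∫ x in halfOpenCube a l, (2 : ℝ) ≤
      ∫ x in halfOpenCube a l, (X⁻¹ * f x + X * (f x)⁻¹) := by
    refine integral_mono_ae (integrableOn_const (by simp [volume_halfOpenCube a hl.le]))
      ((hfi.const_mul _).add (hgi.const_mul _)) (ae_restrict_of_ae ?_)
    filter_upwards [hf] with x hx
    have : X⁻¹ * f x + X * (f x)⁻¹ - 2 = (f x - X) ^ 2 / (X * f x) := by field_simp; ring
    have : 0 ≤ (f x - X) ^ 2 / (X * f x) := by positivity
    linarith
  rw [setIntegral_const, integral_add (hfi.const_mul _) (hgi.const_mul _), integral_const_mul,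
    integral_const_mul, measureReal_def, volume_halfOpenCube a hl.le,
    ENNReal.toReal_ofReal hln.le, smul_eq_mul] at h
  have e1 : ∫ x in halfOpenCube a l, f x = X * l ^ Fintype.card ι := by
    rw [hX, cubeAverage]; field_simp
  have e2 : ∫ x in halfOpenCube a l, (f x)⁻¹ = Y * l ^ Fintype.card ι := by
    rw [hY, cubeAverage]; field_simp
  rw [e1, e2] at h
  have : l ^ Fintype.card ι * 2 ≤ l ^ Fintype.card ι * (1 + X * Y) := by
    convert h using 1; field_simp
  linarith [le_of_mul_le_mul_left this hln]

theorem sum_cubeAverage_childCorner {f : (ι → ℝ) → ℝ} {a : ι → ℝ} {l : ℝ} (hl : 0 < l)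
    (hfi : IntegrableOn f (halfOpenCube a l)) [DecidableEq ι] :
    ∑ e, cubeAverage f (childCorner a l e) (l / 2) =
      Fintype.card (ι → Bool) * cubeAverage f a l := by
  have h := integral_iUnion_fintype (μ := volume) (f := f)
    (s := fun e ↦ halfOpenCube (childCorner a l e) (l / 2))
    (fun e ↦ measurableSet_halfOpenCube _ _) (pairwise_disjoint_halfOpenCube_childCorner a l)
    (fun e ↦ hfi.mono_set
      ((Set.subset_iUnion _ e).trans (iUnion_halfOpenCube_childCorner a hl).subset))
  rw [iUnion_halfOpenCube_childCorner a hl] at h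
  simp only [cubeAverage, ← Finset.sum_div, ← h, Fintype.card_fun, Fintype.card_bool, div_pow]
  push_cast
  field_simp

end Cube

section ReverseHolder

variable {ι : Type*} [Fintype ι] {f : (ι → ℝ) → ℝ} {K ε : ℝ}

theorem rpow_le_a2Bellman {x y : ℝ} (hx : 0 ≤ x) (hxy : 1 ≤ x * y) :
    x ^ (1 + ε) ≤ a2Bellman ε x y := by
  refine le_mul_of_one_le_right (by positivity) ?_
  have : ((x * y) ^ 2)⁻¹ ≤ 1 := inv_le_one_of_one_le₀ (one_le_pow₀ hxy)
  linarith

theorem a2Bellman_le {x y : ℝ} (hx : 0 ≤ x) : a2Bellman ε x y ≤ 2 * x ^ (1 + ε) := by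
  rw [a2Bellman, mul_comm]
  gcongr
  have : 0 ≤ ((x * y) ^ 2)⁻¹ := by positivity
  linarith

theorem exists_dyadic_average_lintegral_rpow_le (hf : ∀ᵐ x, 0 < f x)
    (hfi : ∀ a l, IntegrableOn f (halfOpenCube a l))
    (hgi : ∀ a l, IntegrableOn (fun x ↦ (f x)⁻¹) (halfOpenCube a l))
    (hA : ∀ a l, 0 < l → cubeAverage f a l * cubeAverage (fun x ↦ (f x)⁻¹) a l ≤ K)
    (hε : 0 ≤ ε) (hε' : ε ≤ 1 / 2) (hεK : ε * (8 * (2 ^ Fintype.card ι + 1)) ≤ (K ^ 2)⁻¹)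
    (k : ℕ) (a : ι → ℝ) {l : ℝ} (hl : 0 < l) :
    ∃ g : (ι → ℝ) → ℝ, Measurable g ∧
      (∀ y ∈ halfOpenCube a l, ∃ b,
        y ∈ halfOpenCube b (l / 2 ^ k) ∧ g y = cubeAverage f b (l / 2 ^ k)) ∧
      ∫⁻ y in halfOpenCube a l, ENNReal.ofReal (g y) ^ (1 + ε) ≤ ENNReal.ofReal
        (l ^ Fintype.card ι *
          a2Bellman ε (cubeAverage f a l) (cubeAverage (fun x ↦ (f x)⁻¹) a l)) := by
  classical
  have hfpos : ∀ a {l : ℝ}, 0 < l → 0 < cubeAverage f a l :=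
    fun a l hl ↦ cubeAverage_pos hl hf (hfi a l)
  have hgpos : ∀ a {l : ℝ}, 0 < l → 0 < cubeAverage (fun x ↦ (f x)⁻¹) a l :=
    fun a l hl ↦ cubeAverage_pos hl (hf.mono fun x hx ↦ inv_pos.2 hx) (hgi a l)
  have hB : ∀ a {l : ℝ}, 0 < l → cubeAverage f a l ^ (1 + ε) ≤
      a2Bellman ε (cubeAverage f a l) (cubeAverage (fun x ↦ (f x)⁻¹) a l) := fun a l hl ↦
    rpow_le_a2Bellman (hfpos a hl).le
      (one_le_cubeAverage_mul_cubeAverage_inv hl hf (hfi a l) (hgi a l))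
  induction k generalizing a l with
  | zero =>
    refine ⟨fun _ ↦ cubeAverage f a l, measurable_const, fun y hy ↦ ⟨a, by simpa using hy⟩, ?_⟩
    rw [setLIntegral_const, volume_halfOpenCube a hl.le,
      ENNReal.ofReal_rpow_of_pos (hfpos a hl),
      ← ENNReal.ofReal_mul (Real.rpow_nonneg (hfpos a hl).le _), mul_comm]
    gcongr
    exact hB a hl
  | succ k ih =>
    choose g hgm hgy hgint using fun e ↦ ih (childCorner a l e) (half_pos hl)
    have hg : ∀ e, ∀ y ∈ halfOpenCube (childCorner a l e) (l / 2),
        ∑ e', (halfOpenCube (childCorner a l e') (l / 2)).indicator (g e') y = g e y := by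
      intro e y hy
      rw [Finset.sum_eq_single e, Set.indicator_of_mem hy]
      · intro e' _ hne
        exact Set.indicator_of_notMem (fun h ↦ Set.disjoint_left.1
          (pairwise_disjoint_halfOpenCube_childCorner a l hne) h hy) _
      · simp
    refine ⟨fun y ↦ ∑ e, (halfOpenCube (childCorner a l e) (l / 2)).indicator (g e) y,
      Finset.measurable_sum _ fun e _ ↦ (hgm e).indicator (measurableSet_halfOpenCube _ _),
      fun y hy ↦ ?_, ?_⟩
    · rw [← iUnion_halfOpenCube_childCorner a hl] at hy
      obtain ⟨e, hy⟩ := Set.mem_iUnion.1 hy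
      obtain ⟨b, hb, hgb⟩ := hgy e y hy
      rw [div_div, ← pow_succ'] at hb hgb
      exact ⟨b, hb, (hg e y hy).trans hgb⟩
    · have hn : 0 < l ^ Fintype.card ι := by positivity
      rw [← iUnion_halfOpenCube_childCorner a hl,
        lintegral_iUnion (fun e ↦ measurableSet_halfOpenCube _ _)
          (pairwise_disjoint_halfOpenCube_childCorner a l), tsum_fintype]
      calc _ = ∑ e, ∫⁻ y in halfOpenCube (childCorner a l e) (l / 2),
            ENNReal.ofReal (g e y) ^ (1 + ε) := by
            refine Finset.sum_congr rfl fun e _ ↦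
              setLIntegral_congr_fun (measurableSet_halfOpenCube _ _) fun y hy ↦ ?_
            simp only [hg e y hy]
        _ ≤ _ := Finset.sum_le_sum fun e _ ↦ hgint e
        _ = _ := (ENNReal.ofReal_sum_of_nonneg fun e _ ↦ mul_nonneg (by positivity)
            ((Real.rpow_nonneg (hfpos _ (half_pos hl)).le _).trans (hB _ (half_pos hl)))).symm
        _ ≤ _ := by
            refine ENNReal.ofReal_le_ofReal ?_
            rw [← Finset.mul_sum]
            have := sum_a2Bellman_le (ε := ε) hε hε' (by simpa using hεK) (hfpos a hl) (hgpos a hl)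
              (hA a l hl) (fun e ↦ hfpos (childCorner a l e) (half_pos hl))
              (fun e ↦ hgpos (childCorner a l e) (half_pos hl))
              (sum_cubeAverage_childCorner hl (hfi a l)) (sum_cubeAverage_childCorner hl (hgi a l))
            refine (mul_le_mul_of_nonneg_left this (by positivity)).trans_eq ?_
            simp only [Fintype.card_fun, Fintype.card_bool, div_pow]
            push_cast
            field_simp

theorem lintegral_rpow_halfOpenCube_le (hf : ∀ᵐ x, 0 < f x)
    (hfi : ∀ a l, IntegrableOn f (halfOpenCube a l))
    (hgi : ∀ a l, IntegrableOn (fun x ↦ (f x)⁻¹) (halfOpenCube a l))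
    (hA : ∀ a l, 0 < l → cubeAverage f a l * cubeAverage (fun x ↦ (f x)⁻¹) a l ≤ K)
    (hε : 0 ≤ ε) (hε' : ε ≤ 1 / 2) (hεK : ε * (8 * (2 ^ Fintype.card ι + 1)) ≤ (K ^ 2)⁻¹)
    (a : ι → ℝ) {l : ℝ} (hl : 0 < l) :
    ∫⁻ y in halfOpenCube a l, ENNReal.ofReal (f y) ^ (1 + ε) ≤
      ENNReal.ofReal (l ^ Fintype.card ι * (2 * cubeAverage f a l ^ (1 + ε))) := by
  choose g hgm hgy hgint using fun k ↦
    exists_dyadic_average_lintegral_rpow_le hf hfi hgi hA hε hε' hεK k a hl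
  have hloc : LocallyIntegrable f := by
    intro x
    refine ⟨halfOpenCube (fun i ↦ x i - 1) 2, ?_, hfi _ _⟩
    refine Filter.mem_of_superset (set_pi_mem_nhds (s := fun i ↦ Set.Ioo (x i - 1) (x i + 1))
      Set.finite_univ fun i _ ↦ Ioo_mem_nhds (by linarith) (by linarith)) fun y hy ↦ ?_
    refine mem_halfOpenCube.2 fun i ↦ ?_
    have := hy i trivial
    constructor <;> linarith [this.1, this.2]
  have hδ : Filter.Tendsto (fun k : ℕ ↦ l / 2 ^ k / 2) Filter.atTop (nhdsWithin 0 (Set.Ioi 0)) := by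
    refine tendsto_nhdsWithin_iff.2 ⟨?_, .of_forall fun k ↦ Set.mem_Ioi.2 (by positivity)⟩
    have := (tendsto_pow_atTop_nhds_zero_of_lt_one (r := (1 / 2 : ℝ)) (by norm_num)
      (by norm_num)).const_mul (l / 2)
    rw [mul_zero] at this
    refine this.congr fun k ↦ ?_
    rw [one_div, inv_pow]; field_simp
  have hlim : ∀ᵐ y ∂(volume.restrict (halfOpenCube a l)),
      ENNReal.ofReal (f y) ^ (1 + ε) ≤
        Filter.liminf (fun k ↦ ENNReal.ofReal (g k y) ^ (1 + ε)) Filter.atTop := by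
    filter_upwards [ae_restrict_of_ae (IsUnifLocDoublingMeasure.ae_tendsto_average volume hloc 1),
      ae_restrict_mem (measurableSet_halfOpenCube a l)] with y hy hmem
    choose b hb hgb using fun k ↦ hgy k y hmem
    have hpos : ∀ k : ℕ, 0 ≤ l / 2 ^ k := fun k ↦ by positivity
    have := hy (fun k i ↦ b k i + l / 2 ^ k / 2) _ hδ (.of_forall fun k ↦ by
      rw [one_mul]; exact halfOpenCube_subset_closedBall _ (hpos k) (hb k))
    have hg : Filter.Tendsto (fun k ↦ g k y) Filter.atTop (nhds (f y)) :=
      this.congr fun k ↦ by rw [hgb, cubeAverage_eq_average _ _ (hpos k)]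
    exact ((ENNReal.continuous_rpow_const.tendsto _).comp
      (ENNReal.tendsto_ofReal hg)).liminf_eq.ge
  refine (lintegral_mono_ae hlim).trans ((lintegral_liminf_le fun k ↦ by
    have := hgm k; fun_prop).trans ?_)
  refine Filter.liminf_le_of_frequently_le' (.of_forall fun k ↦ (hgint k).trans ?_)
  gcongr
  exact a2Bellman_le (cubeAverage_pos hl hf (hfi a l)).le

end ReverseHolder

section Transfer

variable {n : ℕ}

theorem toLp_mem_ball_of_mem_halfOpenCube (hn : 1 ≤ n) {x y : Fin n → ℝ} {l : ℝ} (hl : 0 < l)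
    (hy : y ∈ halfOpenCube (fun i ↦ x i - l / 2) l) :
    WithLp.toLp 2 y ∈ ball (WithLp.toLp 2 x) (l * n) := by
  have hn' : (1 : ℝ) ≤ n := by exact_mod_cast hn
  have h1 : dist y x ≤ l / 2 := by
    simpa using halfOpenCube_subset_closedBall _ hl.le hy
  have h2 := (PiLp.lipschitzWith_toLp 2 (fun _ : Fin n ↦ ℝ)).dist_le_mul y x
  have h3 : ((((Fintype.card (Fin n) : ℝ≥0) ^ (1 / (2 : ℝ≥0∞)).toReal : ℝ≥0)) : ℝ) ≤ n := by
    rw [NNReal.coe_rpow]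
    simp only [Fintype.card_fin, NNReal.coe_natCast]
    calc (n : ℝ) ^ (1 / (2 : ℝ≥0∞)).toReal ≤ (n : ℝ) ^ (1 : ℝ) :=
          Real.rpow_le_rpow_of_exponent_le hn' (by norm_num)
      _ = n := Real.rpow_one _
  rw [mem_ball]
  calc _ ≤ _ := h2
    _ ≤ n * (l / 2) := by gcongr
    _ < l * n := by nlinarith

theorem mem_halfOpenCube_of_toLp_mem_ball {x y : Fin n → ℝ} {r : ℝ}
    (hy : WithLp.toLp 2 y ∈ ball (WithLp.toLp 2 x) r) :
    y ∈ halfOpenCube (fun i ↦ x i - r) (2 * r) := by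
  refine mem_halfOpenCube.2 fun i ↦ ?_
  have h := (PiLp.dist_apply_le (WithLp.toLp 2 y) (WithLp.toLp 2 x) i).trans_lt hy
  rw [Real.dist_eq, abs_lt] at h
  simp only [] at h
  constructor <;> linarith [h.1, h.2]

theorem setLIntegral_comp_toLp (F : EuclideanSpace ℝ (Fin n) → ℝ≥0∞)
    (s : Set (EuclideanSpace ℝ (Fin n))) :
    ∫⁻ y in WithLp.toLp 2 ⁻¹' s, F (WithLp.toLp 2 y) = ∫⁻ y in s, F y :=
  (PiLp.volume_preserving_toLp (Fin n)).setLIntegral_comp_preimage_emb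
    (MeasurableEquiv.toLp 2 (Fin n → ℝ)).measurableEmbedding F s

theorem setLIntegral_halfOpenCube_le_ball (hn : 1 ≤ n) (F : EuclideanSpace ℝ (Fin n) → ℝ≥0∞)
    (x : Fin n → ℝ) {l : ℝ} (hl : 0 < l) :
    ∫⁻ y in halfOpenCube (fun i ↦ x i - l / 2) l, F (WithLp.toLp 2 y) ≤
      ∫⁻ y in ball (WithLp.toLp 2 x) (l * n), F y := by
  rw [← setLIntegral_comp_toLp]
  exact lintegral_mono_set fun y hy ↦ toLp_mem_ball_of_mem_halfOpenCube hn hl hy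

theorem setLIntegral_ball_le_halfOpenCube (F : EuclideanSpace ℝ (Fin n) → ℝ≥0∞)
    (x : Fin n → ℝ) (r : ℝ) :
    ∫⁻ y in ball (WithLp.toLp 2 x) r, F y ≤
      ∫⁻ y in halfOpenCube (fun i ↦ x i - r) (2 * r), F (WithLp.toLp 2 y) := by
  rw [← setLIntegral_comp_toLp]
  exact lintegral_mono_set fun y hy ↦ mem_halfOpenCube_of_toLp_mem_ball hy

theorem setLIntegral_ofReal_ball_pos {ω : EuclideanSpace ℝ (Fin n) → ℝ} (hω : Measurable ω)
    (hpos : ∀ᵐ x, 0 < ω x) (x : EuclideanSpace ℝ (Fin n)) {r : ℝ} (hr : 0 < r) :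
    0 < ∫⁻ y in ball x r, ENNReal.ofReal (ω y) := by
  rw [setLIntegral_pos_iff hω.ennreal_ofReal]
  have h : (Function.support (fun y ↦ ENNReal.ofReal (ω y)) ∩ ball x r :
      Set (EuclideanSpace ℝ (Fin n))) =ᵐ[volume] ball x r := by
    filter_upwards [hpos] with y hy
    have : y ∈ Function.support (fun y ↦ ENNReal.ofReal (ω y)) := (ENNReal.ofReal_pos.2 hy).ne'
    exact propext (and_iff_right this)
  rw [measure_congr h]
  exact measure_ball_pos _ _ hr

variable {ω : EuclideanSpace ℝ (Fin n) → ℝ} {C : ℝ≥0}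

theorem IsA2.inv (h : IsA2 n ω C) : IsA2 n (fun x ↦ (ω x)⁻¹) C := fun x r hr ↦ by
  simpa only [inv_inv, mul_comm] using h x r hr

theorem IsA2.setLIntegral_ball_ne_top (h : IsA2 n ω C) (hω : Measurable ω)
    (hpos : ∀ᵐ x, 0 < ω x) (x : EuclideanSpace ℝ (Fin n)) {r : ℝ} (hr : 0 < r) :
    ∫⁻ y in ball x r, ENNReal.ofReal (ω y) ≠ ∞ := by
  intro htop
  have hinv := setLIntegral_ofReal_ball_pos hω.inv (hpos.mono fun y hy ↦ inv_pos.2 hy) x hr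
  have hle := h x r hr
  simp only [Pi.inv_apply] at hinv
  rw [htop, ENNReal.top_mul hinv.ne', top_le_iff] at hle
  exact ENNReal.mul_ne_top ENNReal.coe_ne_top
    (ENNReal.pow_ne_top measure_ball_lt_top.ne) hle

theorem IsA2.toReal_mul_toReal_le (hn : 1 ≤ n) (h : IsA2 n ω C)
    (x : EuclideanSpace ℝ (Fin n)) {r : ℝ} (hr : 0 < r) :
    (∫⁻ y in ball x r, ENNReal.ofReal (ω y)).toReal *
      (∫⁻ y in ball x r, ENNReal.ofReal (ω y)⁻¹).toReal ≤
      C * (r ^ n * volume.real (ball (0 : EuclideanSpace ℝ (Fin n)) 1)) ^ 2 := by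
  have : Nontrivial (EuclideanSpace ℝ (Fin n)) :=
    Module.nontrivial_of_finrank_pos (R := ℝ) (by rw [finrank_euclideanSpace_fin]; omega)
  have hle := ENNReal.toReal_mono (ENNReal.mul_ne_top ENNReal.coe_ne_top
    (ENNReal.pow_ne_top measure_ball_lt_top.ne)) (h x r hr)
  rw [Measure.addHaar_ball _ _ hr.le, finrank_euclideanSpace_fin] at hle
  simpa [ENNReal.toReal_mul, ENNReal.toReal_ofReal (pow_nonneg hr.le n), measureReal_def] using hle

theorem IsA2.integrableOn_halfOpenCube (hn : 1 ≤ n) (h : IsA2 n ω C) (hω : Measurable ω)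
    (hpos : ∀ᵐ x, 0 < ω x) (a : Fin n → ℝ) (l : ℝ) :
    IntegrableOn (fun y ↦ ω (WithLp.toLp 2 y)) (halfOpenCube a l) := by
  have hl : 0 < |l| + 1 := by positivity
  have hpos' : ∀ᵐ y : Fin n → ℝ, 0 < ω (WithLp.toLp 2 y) :=
    (PiLp.volume_preserving_toLp (Fin n)).quasiMeasurePreserving.ae hpos
  have hm : Measurable fun y : Fin n → ℝ ↦ ω (WithLp.toLp 2 y) := by fun_prop
  have hint : IntegrableOn (fun y ↦ ω (WithLp.toLp 2 y)) (halfOpenCube a (|l| + 1)) := by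
    refine ⟨hm.aestronglyMeasurable, ?_⟩
    rw [hasFiniteIntegral_iff_ofReal (ae_restrict_of_ae (hpos'.mono fun y hy ↦ hy.le))]
    have hle := setLIntegral_halfOpenCube_le_ball hn (fun y ↦ ENNReal.ofReal (ω y))
      (fun i ↦ a i + (|l| + 1) / 2) hl
    simp only [add_sub_cancel_right] at hle
    have hn' : (0 : ℝ) < n := by exact_mod_cast hn
    exact hle.trans_lt (h.setLIntegral_ball_ne_top hω hpos _ (by positivity)).lt_top
  refine hint.mono_set fun y hy ↦ mem_halfOpenCube.2 fun i ↦ ?_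
  have := mem_halfOpenCube.1 hy i
  constructor <;> linarith [le_abs_self l]

theorem IsA2.integral_halfOpenCube_le (hn : 1 ≤ n) (h : IsA2 n ω C) (hω : Measurable ω)
    (hpos : ∀ᵐ x, 0 < ω x) (x : Fin n → ℝ) {l : ℝ} (hl : 0 < l) :
    ∫ y in halfOpenCube (fun i ↦ x i - l / 2) l, ω (WithLp.toLp 2 y) ≤
      (∫⁻ y in ball (WithLp.toLp 2 x) (l * n), ENNReal.ofReal (ω y)).toReal := by
  have hpos' : ∀ᵐ y : Fin n → ℝ, 0 < ω (WithLp.toLp 2 y) :=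
    (PiLp.volume_preserving_toLp (Fin n)).quasiMeasurePreserving.ae hpos
  have hm : Measurable fun y : Fin n → ℝ ↦ ω (WithLp.toLp 2 y) := by fun_prop
  have hn' : (0 : ℝ) < n := by exact_mod_cast hn
  rw [integral_eq_lintegral_of_nonneg_ae (ae_restrict_of_ae (hpos'.mono fun y hy ↦ hy.le))
    hm.aestronglyMeasurable]
  exact ENNReal.toReal_mono (h.setLIntegral_ball_ne_top hω hpos _ (by positivity))
    (setLIntegral_halfOpenCube_le_ball hn (fun y ↦ ENNReal.ofReal (ω y)) x hl)

theorem IsA2.cubeAverage_mul_cubeAverage_inv_le (hn : 1 ≤ n) (h : IsA2 n ω C) (hω : Measurable ω)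
    (hpos : ∀ᵐ x, 0 < ω x) (a : Fin n → ℝ) {l : ℝ} (hl : 0 < l) :
    cubeAverage (fun y ↦ ω (WithLp.toLp 2 y)) a l *
      cubeAverage (fun y ↦ (ω (WithLp.toLp 2 y))⁻¹) a l ≤
      C * (n ^ n * volume.real (ball (0 : EuclideanSpace ℝ (Fin n)) 1)) ^ 2 := by
  have hn' : (0 : ℝ) < n := by exact_mod_cast hn
  have hinv : ∀ᵐ x, 0 < (ω x)⁻¹ := hpos.mono fun y hy ↦ inv_pos.2 hy
  have hinv' : ∀ᵐ y : Fin n → ℝ, 0 < (ω (WithLp.toLp 2 y))⁻¹ :=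
    (PiLp.volume_preserving_toLp (Fin n)).quasiMeasurePreserving.ae hinv
  have h1 := h.integral_halfOpenCube_le hn hω hpos (fun i ↦ a i + l / 2) hl
  have h2 := h.inv.integral_halfOpenCube_le hn hω.inv hinv (fun i ↦ a i + l / 2) hl
  have h3 := h.toReal_mul_toReal_le hn (WithLp.toLp 2 fun i ↦ a i + l / 2)
    (show 0 < l * n by positivity)
  simp only [add_sub_cancel_right] at h1 h2
  have h4 : 0 ≤ ∫ y in halfOpenCube a l, (ω (WithLp.toLp 2 y))⁻¹ :=
    integral_nonneg_of_ae (ae_restrict_of_ae (hinv'.mono fun y hy ↦ hy.le))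
  rw [cubeAverage, cubeAverage, div_mul_div_comm, div_le_iff₀ (by positivity), Fintype.card_fin]
  calc _ ≤ _ := mul_le_mul h1 h2 h4 ENNReal.toReal_nonneg
    _ ≤ _ := h3
    _ = _ := by ring

theorem IsA2.toReal_setLIntegral_ball_doubling (hn : 1 ≤ n) (h : IsA2 n ω C) (hω : Measurable ω)
    (hpos : ∀ᵐ x, 0 < ω x) (x : EuclideanSpace ℝ (Fin n)) {r : ℝ} (hr : 0 < r) :
    (∫⁻ y in ball x (2 * r * n), ENNReal.ofReal (ω y)).toReal ≤
      C * ((2 * n ^ 2) ^ n * volume.real (ball (0 : EuclideanSpace ℝ (Fin n)) 1)) ^ 2 *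
        (∫⁻ y in ball x r, ENNReal.ofReal (ω y)).toReal := by
  have hn1 : (1 : ℝ) ≤ n := by exact_mod_cast hn
  have hn' : (0 : ℝ) < n := by linarith
  have hinv : ∀ᵐ x, 0 < (ω x)⁻¹ := hpos.mono fun y hy ↦ inv_pos.2 hy
  have hpos' : ∀ᵐ y : Fin n → ℝ, 0 < ω (WithLp.toLp 2 y) :=
    (PiLp.volume_preserving_toLp (Fin n)).quasiMeasurePreserving.ae hpos
  have hinv' : ∀ᵐ y : Fin n → ℝ, 0 < (ω (WithLp.toLp 2 y))⁻¹ :=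
    (PiLp.volume_preserving_toLp (Fin n)).quasiMeasurePreserving.ae hinv
  have hl : 0 < r / n := by positivity
  have h1 := h.integral_halfOpenCube_le hn hω hpos x.ofLp hl
  have h2 := h.inv.integral_halfOpenCube_le hn hω.inv hinv x.ofLp hl
  rw [div_mul_cancel₀ _ hn'.ne', WithLp.toLp_ofLp] at h1 h2
  set Q := halfOpenCube (fun i ↦ x.ofLp i - r / n / 2) (r / n) with hQ
  have h3 := one_le_cubeAverage_mul_cubeAverage_inv hl hpos'
    (h.integrableOn_halfOpenCube hn hω hpos (fun i ↦ x.ofLp i - r / n / 2) (r / n))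
    (h.inv.integrableOn_halfOpenCube hn hω.inv hinv (fun i ↦ x.ofLp i - r / n / 2) (r / n))
  rw [cubeAverage, cubeAverage, div_mul_div_comm, le_div_iff₀ (by positivity), one_mul,
    Fintype.card_fin, ← hQ] at h3
  have h4 : 0 ≤ ∫ y in Q, (ω (WithLp.toLp 2 y))⁻¹ :=
    integral_nonneg_of_ae (ae_restrict_of_ae (hinv'.mono fun y hy ↦ hy.le))
  have h5 := h.toReal_mul_toReal_le hn x (show 0 < 2 * r * n by positivity)
  have h6 : (∫⁻ y in ball x r, ENNReal.ofReal (ω y)⁻¹).toReal ≤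
      (∫⁻ y in ball x (2 * r * n), ENNReal.ofReal (ω y)⁻¹).toReal :=
    ENNReal.toReal_mono (h.inv.setLIntegral_ball_ne_top hω.inv hinv x (by positivity))
      (lintegral_mono_set (ball_subset_ball (by nlinarith)))
  set I := (∫⁻ y in ball x r, ENNReal.ofReal (ω y)).toReal
  set J := (∫⁻ y in ball x (2 * r * n), ENNReal.ofReal (ω y)⁻¹).toReal
  set I' := (∫⁻ y in ball x (2 * r * n), ENNReal.ofReal (ω y)).toReal
  set v := volume.real (ball (0 : EuclideanSpace ℝ (Fin n)) 1)
  have hI : 0 ≤ I := ENNReal.toReal_nonneg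
  have hI' : 0 ≤ I' := ENNReal.toReal_nonneg
  have h7 : (r / n) ^ n * (r / n) ^ n ≤ I * J :=
    h3.trans (mul_le_mul h1 (h2.trans h6) h4 hI)
  have h8 : 0 < (r / n) ^ n * (r / n) ^ n := by positivity
  refine le_of_mul_le_mul_right ?_ h8
  calc I' * ((r / n) ^ n * (r / n) ^ n) ≤ I' * (I * J) := by gcongr
    _ = I * (I' * J) := by ring
    _ ≤ I * (C * ((2 * r * n) ^ n * v) ^ 2) := by gcongr
    _ = _ := by
      have : (2 * r * n : ℝ) = (2 * n ^ 2) * (r / n) := by field_simp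
      rw [this, mul_pow]
      ring

theorem IsA2.reverse_holder (hn : 1 ≤ n) (h : IsA2 n ω C) (hω : Measurable ω)
    (hpos : ∀ᵐ x, 0 < ω x) {K D ε v : ℝ}
    (hv : v = volume.real (ball (0 : EuclideanSpace ℝ (Fin n)) 1))
    (hK : C * (n ^ n * v) ^ 2 ≤ K) (hD : D = C * ((2 * n ^ 2) ^ n * v) ^ 2)
    (hε : 0 ≤ ε) (hε' : ε ≤ 1 / 2) (hεK : ε * (8 * (2 ^ n + 1)) ≤ (K ^ 2)⁻¹)
    (x : EuclideanSpace ℝ (Fin n)) {ρ : ℝ} (hρ : 0 < ρ) :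
    ((∫⁻ y in ball x ρ, ENNReal.ofReal (ω y) ^ (1 + ε)) / volume (ball x ρ)) ^ (1 / (1 + ε)) ≤
      ENNReal.ofReal ((2 ^ (n + 1) / v) ^ (1 / (1 + ε)) * D * v / 2 ^ n) *
        ((∫⁻ y in ball x ρ, ENNReal.ofReal (ω y)) / volume (ball x ρ)) := by
  have hn' : (0 : ℝ) < n := by exact_mod_cast hn
  have : Nontrivial (EuclideanSpace ℝ (Fin n)) :=
    Module.nontrivial_of_finrank_pos (R := ℝ) (by rw [finrank_euclideanSpace_fin]; omega)
  have hv0 : 0 < v := hv ▸ ENNReal.toReal_pos (measure_ball_pos _ _ one_pos).ne'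
    measure_ball_lt_top.ne
  have hvol : volume (ball x ρ) = ENNReal.ofReal (ρ ^ n * v) := by
    rw [Measure.addHaar_ball _ _ hρ.le, finrank_euclideanSpace_fin,
      ENNReal.ofReal_mul (by positivity), hv, ofReal_measureReal measure_ball_lt_top.ne]
  have hinv : ∀ᵐ x, 0 < (ω x)⁻¹ := hpos.mono fun y hy ↦ inv_pos.2 hy
  have hpos' : ∀ᵐ y : Fin n → ℝ, 0 < ω (WithLp.toLp 2 y) :=
    (PiLp.volume_preserving_toLp (Fin n)).quasiMeasurePreserving.ae hpos
  have hQ := lintegral_rpow_halfOpenCube_le hpos' (h.integrableOn_halfOpenCube hn hω hpos)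
    (h.inv.integrableOn_halfOpenCube hn hω.inv hinv)
    (fun a l hl ↦ (h.cubeAverage_mul_cubeAverage_inv_le hn hω hpos a hl).trans (hv ▸ hK))
    hε hε' (by simpa using hεK) (fun i ↦ x.ofLp i - ρ) (show 0 < 2 * ρ by positivity)
  have hB := (setLIntegral_ball_le_halfOpenCube
    (fun y ↦ ENNReal.ofReal (ω y) ^ (1 + ε)) x.ofLp ρ).trans hQ
  rw [WithLp.toLp_ofLp, Fintype.card_fin] at hB
  set X := cubeAverage (fun y ↦ ω (WithLp.toLp 2 y)) (fun i ↦ x.ofLp i - ρ) (2 * ρ) with hX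
  set I := ∫⁻ y in ball x ρ, ENNReal.ofReal (ω y) with hI
  have hI0 : I ≠ ∞ := h.setLIntegral_ball_ne_top hω hpos x hρ
  have hX0 : 0 ≤ X := (cubeAverage_pos (by positivity) hpos'
    (h.integrableOn_halfOpenCube hn hω hpos _ _)).le
  have hXI : X ≤ D * I.toReal / (2 * ρ) ^ n := by
    have h1 := h.integral_halfOpenCube_le hn hω hpos x.ofLp (show 0 < 2 * ρ by positivity)
    have h2 := h.toReal_setLIntegral_ball_doubling hn hω hpos x hρ
    rw [mul_div_cancel_left₀ ρ two_ne_zero, WithLp.toLp_ofLp] at h1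
    rw [hX, cubeAverage, Fintype.card_fin, hD, hv]
    gcongr
    exact h1.trans h2
  have hr : 0 < 1 + ε := by linarith
  have hD0 : 0 ≤ D := by rw [hD]; positivity
  calc _ ≤ (ENNReal.ofReal ((2 * ρ) ^ n * (2 * X ^ (1 + ε))) /
        ENNReal.ofReal (ρ ^ n * v)) ^ (1 / (1 + ε)) := by
        rw [hvol]; gcongr
    _ = ENNReal.ofReal ((2 ^ (n + 1) / v) ^ (1 / (1 + ε)) * X) := by
        rw [← ENNReal.ofReal_div_of_pos (by positivity),
          ENNReal.ofReal_rpow_of_nonneg (by positivity) (by positivity)]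
        congr 1
        have e : (2 * ρ) ^ n * (2 * X ^ (1 + ε)) / (ρ ^ n * v) =
            2 ^ (n + 1) / v * X ^ (1 + ε) := by
          rw [mul_pow, pow_succ]; field_simp
        rw [e, Real.mul_rpow (by positivity) (by positivity), ← Real.rpow_mul hX0,
          mul_one_div_cancel hr.ne', Real.rpow_one]
    _ ≤ ENNReal.ofReal ((2 ^ (n + 1) / v) ^ (1 / (1 + ε)) * (D * I.toReal / (2 * ρ) ^ n)) := by
        gcongr
    _ = _ := by
        rw [hvol, ← ENNReal.ofReal_toReal hI0, ← ENNReal.ofReal_div_of_pos (by positivity),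
          ← ENNReal.ofReal_mul (by positivity), ENNReal.toReal_ofReal ENNReal.toReal_nonneg]
        congr 1
        rw [mul_pow]; field_simp

end Transfer

/-- Reverse Hölder inequality for `A₂` weights: there are `r > 1` and `C' > 0`, depending
only on `n` and `C`, so that for every `A₂` weight `ω` with constant `C` and every ball `B`
of positive radius, `(⨍_B ω^r)^{1/r} ≤ C' · ⨍_B ω`, all quantities in `[0,∞]`. -/
theorem statement3 (n : ℕ) (hn : 1 ≤ n) (C : ℝ≥0) :
    ∃ (r : ℝ) (C' : ℝ≥0∞), 1 < r ∧ 0 < C' ∧ C' ≠ ∞ ∧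
      ∀ ω : EuclideanSpace ℝ (Fin n) → ℝ, Measurable ω →
        (∀ᵐ x ∂(volume : Measure (EuclideanSpace ℝ (Fin n))), 0 < ω x) →
        IsA2 n ω (C : ℝ≥0∞) →
        ∀ (x : EuclideanSpace ℝ (Fin n)) (ρ : ℝ), 0 < ρ →
          ((∫⁻ y in ball x ρ, (ENNReal.ofReal (ω y)) ^ r) / volume (ball x ρ)) ^ (1 / r) ≤
            C' * ((∫⁻ y in ball x ρ, ENNReal.ofReal (ω y)) / volume (ball x ρ)) := by
  set v := volume.real (ball (0 : EuclideanSpace ℝ (Fin n)) 1) with hv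
  set K : ℝ := C * (n ^ n * v) ^ 2 + 1 with hK
  have hK0 : 0 < K := by positivity
  set ε : ℝ := min (1 / 2) ((K ^ 2)⁻¹ / (8 * (2 ^ n + 1))) with hε
  have hε0 : 0 < ε := lt_min (by norm_num) (by positivity)
  have hεK : ε * (8 * (2 ^ n + 1)) ≤ (K ^ 2)⁻¹ :=
    (le_div_iff₀ (by positivity)).1 (min_le_right _ _)
  refine ⟨1 + ε, ENNReal.ofReal ((2 ^ (n + 1) / v) ^ (1 / (1 + ε)) *
    (C * ((2 * n ^ 2) ^ n * v) ^ 2) * v / 2 ^ n) + 1, by linarith, by positivity, by simp,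
    fun ω hω hpos h x ρ hρ ↦ ?_⟩
  refine (h.reverse_holder hn hω hpos hv (by linarith) rfl hε0.le (min_le_left _ _) hεK x
    hρ).trans ?_
  gcongr
  exact le_self_add
end

section
/- Let n ≥ 1 and let ω : ℝⁿ → ℝ be a measurable function, positive almost everywhere, satisfying the A₂ condition with constant C. Then μ_ω satisfies a 2-Poincaré inequality on balls: there exists a constant c > 0, depending only on n and C, such that for every continuously differentiable function f : ℝⁿ → ℝ and every metric ball B of radius r > 0, ∫_B |f − f_B|² dμ_ω ≤ c · r² · ∫_B ‖∇f‖² dμ_ω, where f_B := (1/μ_ω(B)) ∫_B f dμ_ω denotes the μ_ω-mean of f over B and ∇f the gradient of f. -/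
open MeasureTheory Metric NNReal ENNReal

section WeightedPoincare

theorem sq_lintegral_le_of_sq_le_mul {α : Type*} [MeasurableSpace α] {μ : Measure α}
    {g a b : α → ℝ≥0∞} (ha : AEMeasurable a μ) (hb : AEMeasurable b μ)
    (h : ∀ᵐ x ∂μ, g x ^ 2 ≤ a x * b x) :
    (∫⁻ x, g x ∂μ) ^ 2 ≤ (∫⁻ x, a x ∂μ) * ∫⁻ x, b x ∂μ := by
  have hsq : ∀ u : ℝ≥0∞, (u ^ (1 / 2 : ℝ)) ^ (2 : ℝ) = u := fun u => by
    rw [← ENNReal.rpow_mul]; norm_num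
  have h1 : ∫⁻ x, g x ∂μ ≤ (∫⁻ x, a x ∂μ) ^ (1 / 2 : ℝ) * (∫⁻ x, b x ∂μ) ^ (1 / 2 : ℝ) := by
    have := ENNReal.lintegral_mul_le_Lp_mul_Lq μ (p := 2) (q := 2)
      Real.HolderConjugate.two_two (ha.pow_const (1 / 2 : ℝ)) (hb.pow_const (1 / 2 : ℝ))
    simp only [hsq] at this
    refine le_trans (lintegral_mono_ae ?_) this
    filter_upwards [h] with x hx
    rw [Pi.mul_apply, ← ENNReal.mul_rpow_of_nonneg _ _ (by norm_num)]
    rw [one_div, ENNReal.le_rpow_inv_iff (by norm_num)]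
    exact_mod_cast hx
  calc (∫⁻ x, g x ∂μ) ^ 2
      ≤ ((∫⁻ x, a x ∂μ) ^ (1 / 2 : ℝ) * (∫⁻ x, b x ∂μ) ^ (1 / 2 : ℝ)) ^ 2 := by gcongr
    _ = _ := by
      rw [mul_pow]
      congr 1 <;> · rw [← ENNReal.rpow_ofNat]; exact hsq _

variable {E : Type*} [NormedAddCommGroup E] [NormedSpace ℝ E] [FiniteDimensional ℝ E]
  [MeasurableSpace E] [BorelSpace E]

theorem lintegral_comp_smul_add (μ : Measure E) [μ.IsAddHaarMeasure] {F : E → ℝ≥0∞}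
    (hF : Measurable F) {t : ℝ} (ht : 0 < t) (b : E) :
    ∫⁻ y, F (b + t • y) ∂μ = ENNReal.ofReal ((t ^ Module.finrank ℝ E)⁻¹) * ∫⁻ z, F z ∂μ := by
  have h1 : ∫⁻ y, F (b + t • y) ∂μ = ∫⁻ z, F (b + z) ∂(Measure.map (fun x => t • x) μ) := by
    rw [lintegral_map (by fun_prop) (by fun_prop)]
  rw [h1, Measure.map_addHaar_smul μ ht.ne', lintegral_smul_measure, abs_of_pos (by positivity),
    lintegral_add_left_eq_self F b, smul_eq_mul]

theorem setLIntegral_ball_comp_lineMap (μ : Measure E) [μ.IsAddHaarMeasure] {G : E → ℝ≥0∞}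
    (hG : Measurable G) {t : ℝ} (ht : 0 < t) (x c : E) (r : ℝ) :
    ∫⁻ y in ball c r, G (x + t • (y - x)) ∂μ =
      ENNReal.ofReal ((t ^ Module.finrank ℝ E)⁻¹) *
        ∫⁻ z in ball (x + t • (c - x)) (t * r), G z ∂μ := by
  rw [← lintegral_indicator measurableSet_ball, ← lintegral_indicator measurableSet_ball,
    ← lintegral_comp_smul_add μ (hG.indicator measurableSet_ball) ht (x - t • x)]
  congr 1 with y
  have hy : x - t • x + t • y = x + t • (y - x) := by module
  have hmem : x + t • (y - x) ∈ ball (x + t • (c - x)) (t * r) ↔ y ∈ ball c r := by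
    rw [mem_ball, mem_ball, dist_eq_norm, dist_eq_norm,
      show x + t • (y - x) - (x + t • (c - x)) = t • (y - c) by module, norm_smul,
      Real.norm_of_nonneg ht.le, mul_lt_mul_iff_right₀ ht]
  rw [hy]
  by_cases h : y ∈ ball c r
  · rw [Set.indicator_of_mem h, Set.indicator_of_mem (hmem.2 h)]
  · rw [Set.indicator_of_notMem h, Set.indicator_of_notMem (mt hmem.1 h)]

/-- Averaging over shrunken balls is bounded on `L²(w)`, uniformly in the shrinking factor. -/
theorem lintegral_mul_sq_lintegral_comp_lineMap_le (μ : Measure E) [μ.IsAddHaarMeasure]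
    {w s G : E → ℝ≥0∞} (hw : Measurable w) (hs : Measurable s) (hG : Measurable G)
    (hws : ∀ᵐ x ∂μ, 1 ≤ s x * w x) {K : ℝ≥0∞}
    (hK : ∀ (x : E) (r : ℝ), 0 < r →
      (∫⁻ y in ball x r, w y ∂μ) * (∫⁻ y in ball x r, s y ∂μ) ≤ K * μ (ball x r) ^ 2)
    {t : ℝ} (ht : 0 < t) (ht1 : t ≤ 1) (c : E) {r : ℝ} (hr : 0 < r) :
    ∫⁻ x in ball c r, w x * (∫⁻ y in ball c r, G (x + t • (y - x)) ∂μ) ^ 2 ∂μ ≤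
      K * 4 ^ Module.finrank ℝ E * μ (ball c r) ^ 2 * ∫⁻ z in ball c r, G z ^ 2 * w z ∂μ := by
  set d := Module.finrank ℝ E
  set τ := ENNReal.ofReal ((t ^ d)⁻¹)
  set ρ := 2 * t * r with hρ
  have hρ0 : 0 < ρ := by positivity
  let S : E → ℝ≥0∞ := fun z => ∫⁻ u in ball z ρ, s u ∂μ
  let H : E → ℝ≥0∞ := fun z => G z ^ 2 * w z
  have hH : Measurable H := (hG.pow_const 2).mul hw
  have hdist : MeasurableSet {p : E × E | dist p.2 p.1 < ρ} :=
    measurableSet_lt (by fun_prop) measurable_const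
  have hS : Measurable S := by
    have : S = fun z =>
        ∫⁻ u, {p : E × E | dist p.2 p.1 < ρ}.indicator (fun p => s p.2) (z, u) ∂μ := by
      funext z
      simp only [S]
      rw [← lintegral_indicator measurableSet_ball]
      rfl
    rw [this]
    exact ((hs.comp measurable_snd).indicator hdist).lintegral_prod_right'
  let Φ : E → E → ℝ≥0∞ := fun x z =>
    {p : E × E | dist p.2 p.1 < ρ}.indicator (fun p => w p.1 * (S p.2 * H p.2)) (x, z)
  have hΦ : Measurable (Function.uncurry Φ) :=
    (by fun_prop : Measurable fun p : E × E => w p.1 * (S p.2 * H p.2)).indicator hdist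
  have hpt : ∀ x ∈ ball c r,
      w x * (∫⁻ y in ball c r, G (x + t • (y - x)) ∂μ) ^ 2 ≤
        τ ^ 2 * ∫⁻ z in ball c r, Φ x z ∂μ := by
    intro x hx
    rw [mem_ball, dist_eq_norm] at hx
    have hsub : ball (x + t • (c - x)) (t * r) ⊆ ball c r := by
      apply ball_subset_ball'
      rw [dist_eq_norm, show x + t • (c - x) - c = (1 - t) • (x - c) by module, norm_smul,
        Real.norm_of_nonneg (by linarith)]
      nlinarith
    have hnear : ∀ z ∈ ball (x + t • (c - x)) (t * r),
        dist z x < ρ ∧ ball (x + t • (c - x)) (t * r) ⊆ ball z ρ := by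
      intro z hz
      constructor
      · rw [mem_ball, dist_eq_norm] at hz
        rw [dist_eq_norm, show z - x = (z - (x + t • (c - x))) - t • (x - c) by module]
        refine (norm_sub_le _ _).trans_lt ?_
        rw [norm_smul, Real.norm_of_nonneg ht.le]
        nlinarith
      · intro u hu
        rw [mem_ball] at hz hu ⊢
        have := dist_triangle_right u z (x + t • (c - x))
        linarith
    rw [setLIntegral_ball_comp_lineMap μ hG ht, mul_pow, mul_left_comm]
    gcongr
    have hcs : (∫⁻ z in ball (x + t • (c - x)) (t * r), G z ∂μ) ^ 2 ≤
        (∫⁻ z in ball (x + t • (c - x)) (t * r), s z ∂μ) *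
          ∫⁻ z in ball (x + t • (c - x)) (t * r), H z ∂μ := by
      refine sq_lintegral_le_of_sq_le_mul hs.aemeasurable hH.aemeasurable ?_
      refine ae_restrict_of_ae (hws.mono fun z hz => ?_)
      calc G z ^ 2 = 1 * G z ^ 2 := (one_mul _).symm
        _ ≤ (s z * w z) * G z ^ 2 := by gcongr
        _ = s z * H z := by simp only [H]; ring
    calc w x * (∫⁻ z in ball (x + t • (c - x)) (t * r), G z ∂μ) ^ 2
        ≤ w x * ((∫⁻ z in ball (x + t • (c - x)) (t * r), s z ∂μ) *
          ∫⁻ z in ball (x + t • (c - x)) (t * r), H z ∂μ) := by gcongr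
      _ = ∫⁻ z in ball (x + t • (c - x)) (t * r),
            w x * ((∫⁻ z in ball (x + t • (c - x)) (t * r), s z ∂μ) * H z) ∂μ := by
          rw [lintegral_const_mul _ (by fun_prop), lintegral_const_mul _ hH]
      _ ≤ ∫⁻ z in ball (x + t • (c - x)) (t * r), Φ x z ∂μ := by
          refine setLIntegral_mono' measurableSet_ball fun z hz => ?_
          simp only [Φ]
          rw [Set.indicator_of_mem (show (x, z) ∈ {p : E × E | dist p.2 p.1 < ρ} from (hnear z hz).1)]
          simp only [S]
          gcongr
          exact (hnear z hz).2
      _ ≤ ∫⁻ z in ball c r, Φ x z ∂μ := lintegral_mono_set hsub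
  have hin : ∀ z, ∫⁻ x in ball c r, Φ x z ∂μ ≤ K * μ (ball c ρ) ^ 2 * H z := by
    intro z
    calc ∫⁻ x in ball c r, Φ x z ∂μ ≤ ∫⁻ x, Φ x z ∂μ := setLIntegral_le_lintegral _ _
      _ = ∫⁻ x in ball z ρ, w x * (S z * H z) ∂μ := by
          rw [← lintegral_indicator measurableSet_ball]
          congr 1 with x
          simp only [Φ, Set.indicator, Set.mem_ofPred_eq, mem_ball, dist_comm z x]
      _ = (∫⁻ x in ball z ρ, w x ∂μ) * S z * H z := by
          rw [lintegral_mul_const _ hw, mul_assoc]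
      _ ≤ K * μ (ball z ρ) ^ 2 * H z := by
          gcongr ?_ * _
          exact hK z ρ hρ0
      _ = _ := by rw [Measure.addHaar_ball_center, Measure.addHaar_ball_center μ c]
  have hvol : τ ^ 2 * μ (ball c ρ) ^ 2 = 4 ^ d * μ (ball c r) ^ 2 := by
    rw [hρ, Measure.addHaar_ball_mul_of_pos μ c (by positivity : 0 < 2 * t),
      ← Measure.addHaar_ball_center μ c, mul_pow, ← mul_assoc, ← mul_pow,
      ← ENNReal.ofReal_mul (by positivity), mul_pow 2 t]
    congr 1
    rw [show (t ^ d)⁻¹ * (2 ^ d * t ^ d) = 2 ^ d by field_simp, ENNReal.ofReal_pow (by norm_num),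
      ← pow_mul, mul_comm, pow_mul]
    norm_num
  calc ∫⁻ x in ball c r, w x * (∫⁻ y in ball c r, G (x + t • (y - x)) ∂μ) ^ 2 ∂μ
      ≤ ∫⁻ x in ball c r, τ ^ 2 * ∫⁻ z in ball c r, Φ x z ∂μ ∂μ :=
        setLIntegral_mono' measurableSet_ball hpt
    _ = τ ^ 2 * ∫⁻ z in ball c r, ∫⁻ x in ball c r, Φ x z ∂μ ∂μ := by
        rw [lintegral_const_mul' _ _ (ENNReal.pow_ne_top ENNReal.ofReal_ne_top),
          lintegral_lintegral_swap hΦ.aemeasurable]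
    _ ≤ τ ^ 2 * ∫⁻ z in ball c r, K * μ (ball c ρ) ^ 2 * H z ∂μ := by
        gcongr with z; exact hin z
    _ = K * (τ ^ 2 * μ (ball c ρ) ^ 2) * ∫⁻ z in ball c r, H z ∂μ := by
        rw [lintegral_const_mul _ hH]; ring
    _ = _ := by rw [hvol]; ring

theorem enorm_sub_le_lintegral_enorm_fderiv {E : Type*} [NormedAddCommGroup E]
    [NormedSpace ℝ E] {f : E → ℝ} (hf : ContDiff ℝ 1 f) (x y : E) :
    ‖f y - f x‖ₑ ≤ ‖y - x‖ₑ * ∫⁻ t in Set.Ioc (0 : ℝ) 1, ‖fderiv ℝ f (x + t • (y - x))‖ₑ := by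
  have hcont : Continuous fun t : ℝ => fderiv ℝ f (x + t • (y - x)) (y - x) := by
    have := hf.continuous_fderiv one_ne_zero
    fun_prop
  have hd : ∀ t : ℝ, HasDerivAt (fun t : ℝ => f (x + t • (y - x)))
      (fderiv ℝ f (x + t • (y - x)) (y - x)) t := by
    intro t
    have h1 : HasDerivAt (fun t : ℝ => x + t • (y - x)) (y - x) t := by
      simpa using ((hasDerivAt_id t).smul_const (y - x)).const_add x
    exact ((hf.differentiable one_ne_zero _).hasFDerivAt).comp_hasDerivAt t h1
  have hint := intervalIntegral.integral_eq_sub_of_hasDerivAt (a := 0) (b := 1)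
    (fun t _ => hd t) (hcont.intervalIntegrable _ _)
  simp only [one_smul, zero_smul, add_zero, add_sub_cancel] at hint
  rw [← hint, intervalIntegral.integral_of_le zero_le_one]
  refine (enorm_integral_le_lintegral_enorm _).trans ?_
  rw [← lintegral_const_mul' _ _ enorm_ne_top]
  refine lintegral_mono fun t => ?_
  rw [mul_comm]
  exact ContinuousLinearMap.le_opENorm _ _

theorem enorm_sub_setAverage_sq_le {f : E → ℝ} (hf : ContDiff ℝ 1 f) (μ : Measure E)
    [μ.IsAddHaarMeasure] {c x : E} {r : ℝ} (hx : x ∈ ball c r) :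
    (μ (ball c r) * ‖f x - ⨍ y in ball c r, f y ∂μ‖ₑ) ^ 2 ≤
      ENNReal.ofReal (2 * r) ^ 2 * ∫⁻ t in Set.Ioc (0 : ℝ) 1,
        (∫⁻ y in ball c r, ‖fderiv ℝ f (x + t • (y - x))‖ₑ ∂μ) ^ 2 := by
  have hr : 0 < r := pos_of_mem_ball hx
  have hV0 : μ (ball c r) ≠ 0 := (measure_ball_pos μ c hr).ne'
  have hV : μ (ball c r) ≠ ∞ := measure_ball_lt_top.ne
  have hfi : IntegrableOn f (ball c r) μ :=
    (hf.continuous.continuousOn.integrableOn_compact (isCompact_closedBall c r)).mono_set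
      ball_subset_closedBall
  have hmeas : Measurable (Function.uncurry fun (y : E) (t : ℝ) =>
      ‖fderiv ℝ f (x + t • (y - x))‖ₑ) := by
    have := hf.continuous_fderiv one_ne_zero
    refine Continuous.measurable ?_
    simp only [Function.uncurry_def]
    fun_prop
  have havg : μ (ball c r) * ‖f x - ⨍ y in ball c r, f y ∂μ‖ₑ ≤
      ∫⁻ y in ball c r, ‖f y - f x‖ₑ ∂μ := by
    have h1 : μ.real (ball c r) * (f x - ⨍ y in ball c r, f y ∂μ) =
        -∫ y in ball c r, (f y - f x) ∂μ := by
      rw [integral_sub hfi (integrableOn_const hV), setAverage_eq, setIntegral_const, smul_eq_mul,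
        smul_eq_mul]
      have : μ.real (ball c r) ≠ 0 := (ENNReal.toReal_pos hV0 hV).ne'
      field_simp
      ring
    have h2 : ‖μ.real (ball c r)‖ₑ = μ (ball c r) := by
      rw [Real.enorm_of_nonneg measureReal_nonneg, ofReal_measureReal hV]
    calc _ = ‖μ.real (ball c r) * (f x - ⨍ y in ball c r, f y ∂μ)‖ₑ := by rw [enorm_mul, h2]
      _ ≤ _ := by rw [h1, enorm_neg]; exact enorm_integral_le_lintegral_enorm _
  have hline : ∫⁻ y in ball c r, ‖f y - f x‖ₑ ∂μ ≤ ENNReal.ofReal (2 * r) *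
      ∫⁻ t in Set.Ioc (0 : ℝ) 1, ∫⁻ y in ball c r, ‖fderiv ℝ f (x + t • (y - x))‖ₑ ∂μ := by
    rw [← lintegral_lintegral_swap hmeas.aemeasurable,
      ← lintegral_const_mul' _ _ ENNReal.ofReal_ne_top]
    refine setLIntegral_mono' measurableSet_ball fun y hy => ?_
    refine (enorm_sub_le_lintegral_enorm_fderiv hf x y).trans ?_
    gcongr
    rw [← ofReal_norm, ← dist_eq_norm]
    apply ENNReal.ofReal_le_ofReal
    rw [mem_ball] at hx hy
    linarith [dist_triangle_right y x c]
  have hcs := sq_lintegral_le_of_sq_le_mul (μ := volume.restrict (Set.Ioc (0 : ℝ) 1))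
    (g := fun t => ∫⁻ y in ball c r, ‖fderiv ℝ f (x + t • (y - x))‖ₑ ∂μ) (a := fun _ => 1)
    (b := fun t => (∫⁻ y in ball c r, ‖fderiv ℝ f (x + t • (y - x))‖ₑ ∂μ) ^ 2)
    aemeasurable_const (hmeas.lintegral_prod_left'.pow_const 2).aemeasurable
    (Filter.Eventually.of_forall fun t => (one_mul _).ge)
  rw [setLIntegral_const, Real.volume_Ioc, sub_zero, ENNReal.ofReal_one, mul_one, one_mul] at hcs
  calc _ ≤ (ENNReal.ofReal (2 * r) *
      ∫⁻ t in Set.Ioc (0 : ℝ) 1, ∫⁻ y in ball c r, ‖fderiv ℝ f (x + t • (y - x))‖ₑ ∂μ) ^ 2 := by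
        exact pow_le_pow_left' (havg.trans hline) 2
    _ ≤ _ := by rw [mul_pow]; gcongr

/-- A weighted Poincaré inequality with the unweighted mean subtracted. -/
theorem lintegral_mul_enorm_sub_setAverage_sq_le {f : E → ℝ} (hf : ContDiff ℝ 1 f) (μ : Measure E)
    [μ.IsAddHaarMeasure]
    {w s : E → ℝ≥0∞} (hw : Measurable w) (hs : Measurable s)
    (hws : ∀ᵐ x ∂μ, 1 ≤ s x * w x) {K : ℝ≥0∞}
    (hK : ∀ (x : E) (r : ℝ), 0 < r →
      (∫⁻ y in ball x r, w y ∂μ) * (∫⁻ y in ball x r, s y ∂μ) ≤ K * μ (ball x r) ^ 2)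
    (c : E) {r : ℝ} (hr : 0 < r) :
    ∫⁻ x in ball c r, w x * ‖f x - ⨍ y in ball c r, f y ∂μ‖ₑ ^ 2 ∂μ ≤
      ENNReal.ofReal (2 * r) ^ 2 * (K * 4 ^ Module.finrank ℝ E) *
        ∫⁻ z in ball c r, w z * ‖fderiv ℝ f z‖ₑ ^ 2 ∂μ := by
  have hV0 : μ (ball c r) ^ 2 ≠ 0 := pow_ne_zero 2 (measure_ball_pos μ c hr).ne'
  have hV : μ (ball c r) ^ 2 ≠ ∞ := ENNReal.pow_ne_top measure_ball_lt_top.ne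
  have hcd := hf.continuous_fderiv one_ne_zero
  have hmeas : Measurable fun q : (E × ℝ) × E =>
      ‖fderiv ℝ f (q.1.1 + q.1.2 • (q.2 - q.1.1))‖ₑ :=
    Continuous.measurable (by fun_prop)
  have hP : Measurable fun p : E × ℝ =>
      (∫⁻ y in ball c r, ‖fderiv ℝ f (p.1 + p.2 • (y - p.1))‖ₑ ∂μ) ^ 2 :=
    hmeas.lintegral_prod_right'.pow_const 2
  have hΨ : Measurable (Function.uncurry fun (x : E) (t : ℝ) =>
      w x * (∫⁻ y in ball c r, ‖fderiv ℝ f (x + t • (y - x))‖ₑ ∂μ) ^ 2) :=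
    (hw.comp measurable_fst).mul hP
  refine (ENNReal.mul_le_mul_iff_right hV0 hV).1 ?_
  calc μ (ball c r) ^ 2 * ∫⁻ x in ball c r, w x * ‖f x - ⨍ y in ball c r, f y ∂μ‖ₑ ^ 2 ∂μ
      = ∫⁻ x in ball c r, μ (ball c r) ^ 2 * (w x * ‖f x - ⨍ y in ball c r, f y ∂μ‖ₑ ^ 2) ∂μ :=
        (lintegral_const_mul' _ _ hV).symm
    _ ≤ ∫⁻ x in ball c r, ENNReal.ofReal (2 * r) ^ 2 * (∫⁻ t in Set.Ioc (0 : ℝ) 1,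
          w x * (∫⁻ y in ball c r, ‖fderiv ℝ f (x + t • (y - x))‖ₑ ∂μ) ^ 2) ∂μ := by
        refine setLIntegral_mono' measurableSet_ball fun x hx => ?_
        rw [mul_left_comm, ← mul_pow]
        refine (mul_le_mul_right (enorm_sub_setAverage_sq_le hf μ hx) (w x)).trans ?_
        rw [mul_left_comm]
        exact mul_le_mul_right (lintegral_const_mul_le _ _) _
    _ = ENNReal.ofReal (2 * r) ^ 2 * ∫⁻ t in Set.Ioc (0 : ℝ) 1, ∫⁻ x in ball c r,
          w x * (∫⁻ y in ball c r, ‖fderiv ℝ f (x + t • (y - x))‖ₑ ∂μ) ^ 2 ∂μ := by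
        rw [lintegral_const_mul' _ _ (ENNReal.pow_ne_top ENNReal.ofReal_ne_top),
          lintegral_lintegral_swap hΨ.aemeasurable]
    _ ≤ ENNReal.ofReal (2 * r) ^ 2 * ∫⁻ t in Set.Ioc (0 : ℝ) 1,
          K * 4 ^ Module.finrank ℝ E * μ (ball c r) ^ 2 *
            ∫⁻ z in ball c r, ‖fderiv ℝ f z‖ₑ ^ 2 * w z ∂μ := by
        gcongr 1
        refine setLIntegral_mono' measurableSet_Ioc fun t ht => ?_
        exact lintegral_mul_sq_lintegral_comp_lineMap_le μ hw hs hcd.enorm.measurable hws hK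
          ht.1 ht.2 c hr
    _ = _ := by
        rw [setLIntegral_const, Real.volume_Ioc, sub_zero, ENNReal.ofReal_one, mul_one]
        simp only [mul_comm (w _)]
        ring

/-- The mean minimises the quadratic deviation. -/
theorem lintegral_sq_sub_mean_le {α : Type*} [MeasurableSpace α] {ν : Measure α}
    [IsFiniteMeasure ν] {f : α → ℝ} (hf : MemLp f 2 ν) (a : ℝ) :
    ∫⁻ x, ENNReal.ofReal ((f x - (∫ z, f z ∂ν) / (ν Set.univ).toReal) ^ 2) ∂ν ≤
      ∫⁻ x, ENNReal.ofReal ((f x - a) ^ 2) ∂ν := by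
  rcases eq_or_ne ν 0 with rfl | hν
  · simp
  have hfi : Integrable f ν := hf.integrable (by norm_num)
  have hM : 0 < (ν Set.univ).toReal :=
    ENNReal.toReal_pos (Measure.measure_univ_ne_zero.2 hν) (measure_ne_top _ _)
  set M := (ν Set.univ).toReal with hMdef
  set m := (∫ z, f z ∂ν) / M with hm
  have hI : ∫ z, f z ∂ν = m * M := by rw [hm]; field_simp
  have hsq : ∀ b : ℝ, Integrable (fun x => (f x - b) ^ 2) ν := fun b =>
    (hf.sub (memLp_const b)).integrable_sq
  rw [← ofReal_integral_eq_lintegral_ofReal (hsq m) (Filter.Eventually.of_forall fun _ => sq_nonneg _),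
    ← ofReal_integral_eq_lintegral_ofReal (hsq a) (Filter.Eventually.of_forall fun _ => sq_nonneg _)]
  apply ENNReal.ofReal_le_ofReal
  have key : ∫ x, (f x - a) ^ 2 ∂ν = ∫ x, (f x - m) ^ 2 ∂ν + M * (m - a) ^ 2 := by
    have h1 : ∀ x, (f x - a) ^ 2 = (f x - m) ^ 2 + (2 * (m - a) * f x + (a ^ 2 - m ^ 2)) :=
      fun x => by ring
    simp only [h1]
    have h2 : Integrable (fun x => 2 * (m - a) * f x + (a ^ 2 - m ^ 2)) ν :=
      (hfi.const_mul _).add (integrable_const _)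
    rw [integral_add (hsq m) h2, integral_add (hfi.const_mul _) (integrable_const _),
      integral_const_mul, integral_const, hI,
      smul_eq_mul, measureReal_def, ← hMdef]
    ring
  rw [key]
  nlinarith [mul_nonneg hM.le (sq_nonneg (m - a))]

end WeightedPoincare

theorem muOmega_ball_lt_top {n : ℕ} {ω : EuclideanSpace ℝ (Fin n) → ℝ} (hω : Measurable ω)
    (hpos : ∀ᵐ x, 0 < ω x) {C : ℝ≥0} (hA : IsA2 n ω C) (x : EuclideanSpace ℝ (Fin n)) {r : ℝ}
    (hr : 0 < r) : muOmega n ω (ball x r) < ∞ := by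
  rw [muOmega, withDensity_apply _ measurableSet_ball, lt_top_iff_ne_top]
  intro htop
  have h := hA x r hr
  rw [htop, ENNReal.top_mul, top_le_iff] at h
  · exact ENNReal.mul_ne_top ENNReal.coe_ne_top (ENNReal.pow_ne_top measure_ball_lt_top.ne) h
  · rw [Ne, lintegral_eq_zero_iff (by fun_prop)]
    intro h0
    have hfalse : ∀ᵐ y ∂(volume.restrict (ball x r)), False := by
      filter_upwards [h0, ae_restrict_of_ae hpos] with y hy hy'
      have : 0 < ENNReal.ofReal (ω y)⁻¹ := ENNReal.ofReal_pos.2 (inv_pos.2 hy')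
      exact this.ne' hy
    rw [Filter.eventually_false_iff_eq_bot, ae_eq_bot, Measure.restrict_eq_zero] at hfalse
    exact (measure_ball_pos volume x hr).ne' hfalse

/-- Weighted `2`-Poincaré inequality on balls for `A₂` weights: there is `c > 0`,
depending only on `n` and `C`, so that for every `A₂` weight `ω` with constant `C`,
every `C¹` function `f` and every ball `B = B(x,r)`,
`∫_B |f - f_B|² dμ_ω ≤ c r² ∫_B ‖∇f‖² dμ_ω`, where `f_B` is the `μ_ω`-mean of `f`
over `B`. -/
theorem statement5 (n : ℕ) (hn : 1 ≤ n) (C : ℝ≥0) :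
    ∃ c : ℝ, 0 < c ∧
      ∀ ω : EuclideanSpace ℝ (Fin n) → ℝ, Measurable ω →
        (∀ᵐ x ∂(volume : Measure (EuclideanSpace ℝ (Fin n))), 0 < ω x) →
        IsA2 n ω (C : ℝ≥0∞) →
        ∀ f : EuclideanSpace ℝ (Fin n) → ℝ, ContDiff ℝ 1 f →
          ∀ (x : EuclideanSpace ℝ (Fin n)) (r : ℝ), 0 < r →
            (∫⁻ y in ball x r,
                ENNReal.ofReal ((f y -
                    (∫ z in ball x r, f z ∂(muOmega n ω)) /
                      (muOmega n ω (ball x r)).toReal) ^ 2) ∂(muOmega n ω)) ≤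
              ENNReal.ofReal (c * r ^ 2) *
                ∫⁻ y in ball x r, ENNReal.ofReal (‖gradient f y‖ ^ 2) ∂(muOmega n ω) := by
  refine ⟨4 * (C * 4 ^ n) + 1, by positivity, fun ω hω hpos hA f hf x r hr => ?_⟩
  have hw : Measurable fun y => ENNReal.ofReal (ω y) := by fun_prop
  have hs : Measurable fun y => ENNReal.ofReal (ω y)⁻¹ := by fun_prop
  have hws : ∀ᵐ y, 1 ≤ ENNReal.ofReal (ω y)⁻¹ * ENNReal.ofReal (ω y) := by
    filter_upwards [hpos] with y hy
    rw [← ENNReal.ofReal_mul (inv_nonneg.2 hy.le), inv_mul_cancel₀ hy.ne', ENNReal.ofReal_one]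
  have hfin := muOmega_ball_lt_top hω hpos hA x hr
  have : IsFiniteMeasure ((muOmega n ω).restrict (ball x r)) := ⟨by simpa using hfin⟩
  have hL2 : MemLp f 2 ((muOmega n ω).restrict (ball x r)) := by
    obtain ⟨M, hM⟩ := (isCompact_closedBall x r).exists_bound_of_continuousOn
      hf.continuous.continuousOn
    exact MemLp.of_bound hf.continuous.aestronglyMeasurable M
      ((ae_restrict_mem measurableSet_ball).mono fun y hy => hM y (ball_subset_closedBall hy))
  have hmean := lintegral_sq_sub_mean_le hL2 (⨍ y in ball x r, f y)
  rw [Measure.restrict_apply_univ] at hmean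
  refine hmean.trans ?_
  have hcd := hf.continuous_fderiv one_ne_zero
  have hgrad : ∀ y, ENNReal.ofReal (‖gradient f y‖ ^ 2) = ‖fderiv ℝ f y‖ₑ ^ 2 := fun y => by
    rw [gradient, LinearIsometryEquiv.norm_map, ENNReal.ofReal_pow (norm_nonneg _), ofReal_norm]
  have hdev : ∀ u : ℝ, ENNReal.ofReal (u ^ 2) = ‖u‖ₑ ^ 2 := fun u => by
    rw [← sq_abs, ENNReal.ofReal_pow (abs_nonneg _), ← Real.enorm_eq_ofReal_abs]
  simp only [hgrad, hdev]
  have hfm := hf.continuous.measurable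
  rw [muOmega, setLIntegral_withDensity_eq_setLIntegral_mul _ hw (by fun_prop) measurableSet_ball,
    setLIntegral_withDensity_eq_setLIntegral_mul _ hw (hcd.enorm.measurable.pow_const 2)
      measurableSet_ball]
  refine (lintegral_mul_enorm_sub_setAverage_sq_le hf volume hw hs hws hA x hr).trans ?_
  rw [finrank_euclideanSpace_fin]
  refine mul_le_mul_left ?_ _
  have hC : (C : ℝ≥0∞) * 4 ^ n = ENNReal.ofReal (C * 4 ^ n) := by
    rw [ENNReal.ofReal_mul C.coe_nonneg, ENNReal.ofReal_coe_nnreal, ENNReal.ofReal_pow (by norm_num)]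
    norm_num
  rw [hC, ← ENNReal.ofReal_pow (by positivity), ← ENNReal.ofReal_mul (by positivity)]
  apply ENNReal.ofReal_le_ofReal
  nlinarith [sq_nonneg r]
end

section
/- Let n ≥ 1 and α ∈ ℝ. The weight ω(x) = ‖x‖^α on ℝⁿ satisfies the A₂ condition for some finite constant if and only if −n < α < n. Precisely: there exists C < ∞ such that for every metric ball B ⊆ ℝⁿ of positive radius, (⨍_B ‖x‖^α dx)·(⨍_B ‖x‖^{−α} dx) ≤ C (the averages being taken as extended-real integrals in [0,∞]) if and only if −n < α < n. -/
open MeasureTheory Metric NNReal ENNReal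

theorem measurable_norm_rpow {E : Type*} [NormedAddCommGroup E] [MeasurableSpace E]
    [BorelSpace E] (β : ℝ) :
    Measurable fun y : E => ‖y‖ ^ β := by fun_prop

theorem norm_rpow_le_of_mem_ball {E : Type*} [SeminormedAddCommGroup E] (β : ℝ) {x y : E} {r : ℝ}
    (hx : 2 * r < ‖x‖) (hy : y ∈ ball x r) : ‖y‖ ^ β ≤ 2 ^ |β| * ‖x‖ ^ β := by
  rw [mem_ball, dist_eq_norm] at hy
  have h1 := norm_sub_norm_le x y
  have h2 := norm_sub_norm_le y x
  rw [norm_sub_rev] at h1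
  have hx0 : 0 < ‖x‖ := by linarith [norm_nonneg (y - x)]
  have hy0 : 0 < ‖y‖ := by linarith
  rcases le_total 0 β with hβ | hβ
  · rw [abs_of_nonneg hβ, ← Real.mul_rpow zero_le_two hx0.le]
    exact Real.rpow_le_rpow hy0.le (by linarith) hβ
  · rw [abs_of_nonpos hβ, Real.rpow_neg zero_le_two, ← Real.inv_rpow zero_le_two,
      ← Real.mul_rpow (by positivity) hx0.le]
    exact Real.rpow_le_rpow_of_nonpos (by positivity) (by linarith) hβ

theorem lintegral_norm_rpow_ball_le_of_two_mul_lt {E : Type*} [NormedAddCommGroup E]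
    [MeasurableSpace E] [BorelSpace E] (μ : Measure E) (β : ℝ) {x : E} {r : ℝ} (hx : 2 * r < ‖x‖) :
    ∫⁻ y in ball x r, ENNReal.ofReal (‖y‖ ^ β) ∂μ ≤
      ENNReal.ofReal (2 ^ |β| * ‖x‖ ^ β) * μ (ball x r) := by
  rw [← setLIntegral_const]
  exact setLIntegral_mono' measurableSet_ball fun y hy =>
    ENNReal.ofReal_le_ofReal (norm_rpow_le_of_mem_ball β hx hy)

theorem lintegral_norm_rpow_mul_le_of_two_mul_lt {E : Type*} [NormedAddCommGroup E]
    [MeasurableSpace E] [BorelSpace E] (μ : Measure E) (α : ℝ) {x : E} {r : ℝ} (hr : 0 < r)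
    (hx : 2 * r < ‖x‖) :
    (∫⁻ y in ball x r, ENNReal.ofReal (‖y‖ ^ α) ∂μ) *
        (∫⁻ y in ball x r, ENNReal.ofReal (‖y‖ ^ (-α)) ∂μ) ≤
      ENNReal.ofReal (2 ^ |α| * 2 ^ |α|) * μ (ball x r) ^ 2 := by
  have hx0 : 0 < ‖x‖ := by linarith
  calc
    _ ≤ (ENNReal.ofReal (2 ^ |α| * ‖x‖ ^ α) * μ (ball x r)) *
        (ENNReal.ofReal (2 ^ |-α| * ‖x‖ ^ (-α)) * μ (ball x r)) :=
      mul_le_mul' (lintegral_norm_rpow_ball_le_of_two_mul_lt μ α hx)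
        (lintegral_norm_rpow_ball_le_of_two_mul_lt μ (-α) hx)
    _ = ENNReal.ofReal ((2 ^ |α| * ‖x‖ ^ α) * (2 ^ |-α| * ‖x‖ ^ (-α))) * μ (ball x r) ^ 2 := by
      rw [ENNReal.ofReal_mul (p := 2 ^ |α| * ‖x‖ ^ α) (by positivity)]
      ring
    _ = _ := by
      rw [mul_mul_mul_comm, ← Real.rpow_add hx0, add_neg_cancel, Real.rpow_zero, mul_one, abs_neg]

section PowerWeight

variable {E : Type*} [NormedAddCommGroup E] [NormedSpace ℝ E] [FiniteDimensional ℝ E]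
  [MeasurableSpace E] [BorelSpace E] (μ : Measure E) [μ.IsAddHaarMeasure]

theorem integrableOn_norm_rpow_ball_iff [Nontrivial E] (β : ℝ) {r : ℝ} (hr : 0 < r) :
    IntegrableOn (fun y : E => ‖y‖ ^ β) (ball 0 r) μ ↔ -(Module.finrank ℝ E : ℝ) < β := by
  have hd : 1 ≤ Module.finrank ℝ E := Module.finrank_pos
  rw [integrableOn_fun_norm_addHaar μ (f := fun t : ℝ => t ^ β),
    integrableOn_congr_fun (g := fun t : ℝ => t ^ ((Module.finrank ℝ E : ℝ) - 1 + β)) _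
      measurableSet_Ioo,
    intervalIntegral.integrableOn_Ioo_rpow_iff hr]
  · constructor <;> intro h <;> linarith
  · intro t ht
    simp only [smul_eq_mul]
    rw [Real.rpow_add ht.1, ← Nat.cast_pred hd, Real.rpow_natCast]

theorem lintegral_norm_rpow_ball_ne_top_iff [Nontrivial E] (β : ℝ) {r : ℝ} (hr : 0 < r) :
    ∫⁻ y in ball (0 : E) r, ENNReal.ofReal (‖y‖ ^ β) ∂μ ≠ ∞ ↔
      -(Module.finrank ℝ E : ℝ) < β := by
  rw [lintegral_ofReal_ne_top_iff_integrable (measurable_norm_rpow β).aestronglyMeasurable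
    (ae_of_all _ fun y => by positivity)]
  exact integrableOn_norm_rpow_ball_iff μ β hr

theorem lintegral_norm_rpow_ball_pos [Nontrivial E] (β : ℝ) {r : ℝ} (hr : 0 < r) :
    0 < ∫⁻ y in ball (0 : E) r, ENNReal.ofReal (‖y‖ ^ β) ∂μ := by
  rw [setLIntegral_pos_iff (measurable_norm_rpow β).ennreal_ofReal]
  have hsub : ball (0 : E) r \ {0} ⊆
      Function.support (fun y : E => ENNReal.ofReal (‖y‖ ^ β)) ∩ ball 0 r := by
    rintro y ⟨hy, hy0⟩
    refine ⟨?_, hy⟩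
    have : 0 < ‖y‖ := norm_pos_iff.2 hy0
    simp only [Function.mem_support, ne_eq, ENNReal.ofReal_eq_zero, not_le]
    positivity
  refine lt_of_lt_of_le ?_ (measure_mono hsub)
  rw [measure_sdiff_null (measure_singleton _)]
  exact measure_ball_pos μ 0 hr

theorem lintegral_norm_rpow_ball [Nontrivial E] {β : ℝ} (hβ : -(Module.finrank ℝ E : ℝ) < β)
    {r : ℝ} (hr : 0 < r) :
    ∫⁻ y in ball (0 : E) r, ENNReal.ofReal (‖y‖ ^ β) ∂μ =
      ENNReal.ofReal (r ^ Module.finrank ℝ E * r ^ β) *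
        ∫⁻ y in ball (0 : E) 1, ENNReal.ofReal (‖y‖ ^ β) ∂μ := by
  rw [← ofReal_integral_eq_lintegral_ofReal ((integrableOn_norm_rpow_ball_iff μ β hr).2 hβ)
      (ae_of_all _ fun y => by positivity),
    ← ofReal_integral_eq_lintegral_ofReal ((integrableOn_norm_rpow_ball_iff μ β one_pos).2 hβ)
      (ae_of_all _ fun y => by positivity), ← ENNReal.ofReal_mul (by positivity)]
  congr 1
  have h := Measure.setIntegral_comp_smul_of_pos μ (fun y : E => ‖y‖ ^ β) (ball 0 1) hr
  simp only [norm_smul, Real.norm_of_nonneg hr.le, Real.mul_rpow hr.le (norm_nonneg _),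
    integral_const_mul, smul_unitBall_of_pos hr, smul_eq_mul] at h
  rw [mul_assoc, h, mul_inv_cancel_left₀ (by positivity)]

theorem lintegral_norm_rpow_mul_le_of_le_two_mul [Nontrivial E] {α : ℝ}
    (h₁ : -(Module.finrank ℝ E : ℝ) < α) (h₂ : α < Module.finrank ℝ E) {x : E} {r : ℝ}
    (hr : 0 < r) (hx : ‖x‖ ≤ 2 * r) :
    (∫⁻ y in ball x r, ENNReal.ofReal (‖y‖ ^ α) ∂μ) *
        (∫⁻ y in ball x r, ENNReal.ofReal (‖y‖ ^ (-α)) ∂μ) ≤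
      ENNReal.ofReal ((3 ^ Module.finrank ℝ E) ^ 2) *
        ((∫⁻ y in ball (0 : E) 1, ENNReal.ofReal (‖y‖ ^ α) ∂μ) *
          (∫⁻ y in ball (0 : E) 1, ENNReal.ofReal (‖y‖ ^ (-α)) ∂μ)) / μ (ball 0 1) ^ 2 *
        μ (ball x r) ^ 2 := by
  have hsub : ball x r ⊆ ball 0 (3 * r) :=
    ball_subset_ball' (by rw [dist_zero_right]; linarith)
  have h3 : 0 < 3 * r := by positivity
  have hv0 : μ (ball (0 : E) 1) ^ 2 ≠ 0 := pow_ne_zero _ (measure_ball_pos μ 0 one_pos).ne'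
  have hv : μ (ball (0 : E) 1) ^ 2 ≠ ∞ := ENNReal.pow_ne_top measure_ball_lt_top.ne
  refine (mul_le_mul' (lintegral_mono_set hsub) (lintegral_mono_set hsub)).trans (le_of_eq ?_)
  rw [lintegral_norm_rpow_ball μ h₁ h3, lintegral_norm_rpow_ball μ (by linarith) h3,
    Measure.addHaar_ball_of_pos μ x hr, mul_pow (ENNReal.ofReal _), mul_comm (_ ^ 2) (μ _ ^ 2),
    ← mul_assoc (_ / _),
    ENNReal.div_mul_cancel hv0 hv, mul_mul_mul_comm, ← ENNReal.ofReal_mul (by positivity),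
    mul_mul_mul_comm, ← Real.rpow_add h3, add_neg_cancel, Real.rpow_zero, mul_one,
    ← ENNReal.ofReal_pow (by positivity), mul_right_comm, ← ENNReal.ofReal_mul (by positivity)]
  congr 2
  ring

end PowerWeight

/-- The power weight `ω(x) = ‖x‖^α` on `ℝⁿ` satisfies the `A₂` condition for some finite
constant — i.e. there is `C < ∞` with
`(∫_B ‖x‖^α dx) · (∫_B ‖x‖^{-α} dx) ≤ C · vol(B)²` for every ball `B` of positive radius,
the integrals taken in `[0,∞]` — if and only if `-n < α < n`. -/
theorem statement6 (n : ℕ) (hn : 1 ≤ n) (α : ℝ) :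
    (∃ C : ℝ≥0, ∀ (x : EuclideanSpace ℝ (Fin n)) (r : ℝ), 0 < r →
        (∫⁻ y in ball x r, ENNReal.ofReal (‖y‖ ^ α)) *
          (∫⁻ y in ball x r, ENNReal.ofReal (‖y‖ ^ (-α))) ≤
          (C : ℝ≥0∞) * (volume (ball x r)) ^ 2) ↔
      (-(n : ℝ) < α ∧ α < n) := by
  have : Nonempty (Fin n) := ⟨⟨0, hn⟩⟩
  have hfin := fun β : ℝ =>
    lintegral_norm_rpow_ball_ne_top_iff (volume : Measure (EuclideanSpace ℝ (Fin n))) β one_pos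
  simp only [finrank_euclideanSpace_fin] at hfin
  constructor
  · rintro ⟨C, hC⟩
    have hlt := ((hC 0 1 one_pos).trans_lt (ENNReal.mul_lt_top ENNReal.coe_lt_top
      (ENNReal.pow_lt_top measure_ball_lt_top))).ne
    have hpos := fun β : ℝ => (lintegral_norm_rpow_ball_pos
      (volume : Measure (EuclideanSpace ℝ (Fin n))) β one_pos).ne'
    have hα := (hfin α).1 fun h => hlt (by rw [h, ENNReal.top_mul (hpos _)])
    have hα' := (hfin (-α)).1 fun h => hlt (by rw [h, ENNReal.mul_top (hpos _)])
    exact ⟨hα, by linarith⟩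
  · rintro ⟨h₁, h₂⟩
    set K : ℝ≥0∞ := ENNReal.ofReal ((3 ^ n) ^ 2) *
      ((∫⁻ y in ball (0 : EuclideanSpace ℝ (Fin n)) 1, ENNReal.ofReal (‖y‖ ^ α)) *
        (∫⁻ y in ball (0 : EuclideanSpace ℝ (Fin n)) 1, ENNReal.ofReal (‖y‖ ^ (-α)))) /
      volume (ball (0 : EuclideanSpace ℝ (Fin n)) 1) ^ 2 with hK
    have hK_top : K ≠ ∞ := ENNReal.div_ne_top
      (ENNReal.mul_ne_top ENNReal.ofReal_ne_top
        (ENNReal.mul_ne_top ((hfin _).2 h₁) ((hfin _).2 (by linarith))))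
      (pow_ne_zero _ (measure_ball_pos _ 0 one_pos).ne')
    refine ⟨(K + ENNReal.ofReal (2 ^ |α| * 2 ^ |α|)).toNNReal, fun x r hr => ?_⟩
    rw [ENNReal.coe_toNNReal (ENNReal.add_ne_top.2 ⟨hK_top, ENNReal.ofReal_ne_top⟩), add_mul]
    rcases le_or_gt ‖x‖ (2 * r) with hx | hx
    · have h := lintegral_norm_rpow_mul_le_of_le_two_mul volume (x := x) (α := α)
        (by simpa using h₁) (by simpa using h₂) hr hx
      rw [finrank_euclideanSpace_fin] at h
      exact h.trans le_self_add
    · exact (lintegral_norm_rpow_mul_le_of_two_mul_lt volume α hr hx).trans le_add_self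
end

section
/- Let k ≥ 1, m ≥ 1, and write points of ℝ^{k+m} = ℝᵏ × ℝᵐ as pairs (x,y). Let ω : ℝᵏ × ℝᵐ → ℝ be measurable and positive almost everywhere, let K ⊆ ℝᵏ be measurable with finite Lebesgue measure 𝓛ᵏ(K) < ∞, let R > 0, and let u : ℝᵏ × ℝᵐ → ℝ be continuously differentiable with compact support contained in ℝᵏ × closedBall(0,R) and with u(x,0) = 1 for all x ∈ K. Then, with both factors on the right interpreted as extended-real integrals in [0,∞], (m · vol_m(B(0,1)) · 𝓛ᵏ(K))² ≤ (∫_{ℝᵏ×ℝᵐ} ‖∇u‖² ω d𝓛^{k+m}) · (∫_{K × B(0,R)} ‖y‖^{2(1−m)} ω(x,y)^{−1} d𝓛^{k+m}(x,y)), where vol_m(B(0,1)) is the Lebesgue measure of the unit ball in ℝᵐ. -/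
open MeasureTheory Metric NNReal ENNReal

/-- Integration in polar coordinates for the Lebesgue integral. -/
lemma lintegral_eq_lintegral_toSphere {E : Type*} [NormedAddCommGroup E] [NormedSpace ℝ E]
    [MeasurableSpace E] [BorelSpace E] [FiniteDimensional ℝ E] [Nontrivial E]
    (μ : Measure E) [μ.IsAddHaarMeasure] {f : E → ℝ≥0∞} (hf : Measurable f) :
    ∫⁻ x, f x ∂μ = ∫⁻ θ : sphere (0 : E) 1, (∫⁻ r in Set.Ioi (0 : ℝ),
      ENNReal.ofReal (r ^ (Module.finrank ℝ E - 1)) * f (r • (θ : E))) ∂μ.toSphere := by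
  have hsymm : Measurable fun z : sphere (0 : E) 1 × Set.Ioi (0 : ℝ) => f (z.2.1 • z.1.1) :=
    hf.comp (by fun_prop)
  calc
    ∫⁻ x, f x ∂μ = ∫⁻ x : ({(0)}ᶜ : Set E), f x ∂(μ.comap (↑)) := by
      rw [lintegral_subtype_comap (measurableSet_singleton _).compl, restrict_compl_singleton]
    _ = ∫⁻ z, f (z.2.1 • z.1.1)
        ∂μ.toSphere.prod (Measure.volumeIoiPow (Module.finrank ℝ E - 1)) := by
      rw [← μ.measurePreserving_homeomorphUnitSphereProd.lintegral_comp hsymm]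
      refine lintegral_congr fun x => ?_
      rw [← homeomorphUnitSphereProd_symm_apply_coe, Homeomorph.symm_apply_apply]
    _ = _ := by
      rw [lintegral_prod _ hsymm.aemeasurable]
      refine lintegral_congr fun θ => ?_
      have hray : Measurable fun r : Set.Ioi (0 : ℝ) => f (r.1 • (θ : E)) :=
        hf.comp (by fun_prop)
      refine (lintegral_withDensity_eq_lintegral_mul _ (by fun_prop) hray).trans ?_
      exact lintegral_subtype_comap measurableSet_Ioi
        fun r : ℝ => ENNReal.ofReal (r ^ (Module.finrank ℝ E - 1)) * f (r • (θ : E))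

lemma enorm_apply_zero_le_lintegral_radial {E : Type*} [NormedAddCommGroup E] [NormedSpace ℝ E]
    {v : E → ℝ} (hv : ContDiff ℝ 1 v) {R : ℝ} (hR : 0 ≤ R) {θ : E} (hθ : ‖θ‖ = 1)
    (h0 : v (R • θ) = 0) :
    ‖v 0‖ₑ ≤ ∫⁻ r in Set.Ioo 0 R, ‖fderiv ℝ v (r • θ)‖ₑ := by
  have hc : ContDiff ℝ 1 fun r : ℝ => v (r • θ) := hv.comp (by fun_prop)
  have h := enorm_sub_le_lintegral_deriv_of_contDiffOn_Icc hc.contDiffOn hR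
  rw [h0, zero_smul, zero_sub, enorm_neg] at h
  rw [Measure.restrict_congr_set Ioo_ae_eq_Icc]
  refine h.trans (lintegral_mono fun r => ?_)
  have hd : HasDerivAt (fun r : ℝ => v (r • θ)) (fderiv ℝ v (r • θ) θ) r := by
    have h1 := (hv.differentiable one_ne_zero (r • θ)).hasFDerivAt
    have h2 : HasDerivAt (fun r : ℝ => r • θ) θ r := by
      simpa using (hasDerivAt_id r).smul_const θ
    exact h1.comp_hasDerivAt r h2
  rw [hd.deriv, enorm_le_iff_norm_le]
  simpa [hθ] using (fderiv ℝ v (r • θ)).le_opNorm θ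

/-- The representation-formula bound for the value at the centre of a ball of a `C¹` function
that vanishes outside that ball. -/
lemma measure_ball_mul_enorm_apply_zero_le {E : Type*} [NormedAddCommGroup E] [NormedSpace ℝ E]
    [MeasurableSpace E] [BorelSpace E] [FiniteDimensional ℝ E] [Nontrivial E]
    (μ : Measure E) [μ.IsAddHaarMeasure] {v : E → ℝ} (hv : ContDiff ℝ 1 v) {R : ℝ} (hR : 0 < R)
    (hsupp : Function.support v ⊆ closedBall 0 R) :
    (Module.finrank ℝ E : ℝ≥0∞) * μ (ball 0 1) * ‖v 0‖ₑ ≤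
      ∫⁻ y in ball 0 R, ‖fderiv ℝ v y‖ₑ * ‖y‖ₑ ^ (1 - (Module.finrank ℝ E : ℝ)) ∂μ := by
  have hm : Measurable fun y => ‖fderiv ℝ v y‖ₑ * ‖y‖ₑ ^ (1 - (Module.finrank ℝ E : ℝ)) :=
    (hv.continuous_fderiv one_ne_zero).enorm.measurable.mul (by fun_prop)
  rw [← lintegral_indicator measurableSet_ball,
    lintegral_eq_lintegral_toSphere μ (hm.indicator measurableSet_ball),
    ← μ.toSphere_apply_univ, mul_comm, ← lintegral_const]
  refine lintegral_mono fun θ => ?_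
  have hθ : ‖(θ : E)‖ = 1 := norm_eq_of_mem_sphere θ
  have h0 : v (R • (θ : E)) = 0 := by
    by_contra h
    have := interior_maximal hsupp hv.continuous.isOpen_support h
    rw [interior_closedBall _ hR.ne', mem_ball_zero_iff, norm_smul, hθ,
      Real.norm_of_nonneg hR.le] at this
    linarith
  refine (enorm_apply_zero_le_lintegral_radial hv hR.le hθ h0).trans ?_
  refine le_trans (le_of_eq (setLIntegral_congr_fun measurableSet_Ioo fun r hr => ?_))
    (lintegral_mono_set Set.Ioo_subset_Ioi_self)
  have hmem : r • (θ : E) ∈ ball (0 : E) R := by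
    simpa [norm_smul, hθ, abs_of_pos hr.1] using hr.2
  have hr0 : ‖r • (θ : E)‖ₑ = ENNReal.ofReal r := by
    rw [← ofReal_norm, norm_smul, hθ, mul_one, Real.norm_of_nonneg hr.1.le]
  have hpos : ENNReal.ofReal r ≠ 0 := by simpa using hr.1
  have hdim : ((Module.finrank ℝ E - 1 : ℕ) : ℝ) = (Module.finrank ℝ E : ℝ) - 1 := by
    rw [Nat.cast_sub Module.finrank_pos, Nat.cast_one]
  rw [Set.indicator_of_mem hmem, hr0, ENNReal.ofReal_pow hr.1.le, mul_left_comm,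
    ← ENNReal.rpow_natCast, ← ENNReal.rpow_add _ _ hpos ofReal_ne_top, hdim]
  simp

/-- Weighted Cauchy–Schwarz inequality in `[0, ∞]`. -/
lemma sq_lintegral_mul_le_weighted {α : Type*} [MeasurableSpace α] (μ : Measure α)
    {f g w : α → ℝ≥0∞} (hf : AEMeasurable f μ) (hg : AEMeasurable g μ) (hw : AEMeasurable w μ)
    (hw0 : ∀ᵐ a ∂μ, w a ≠ 0) (hw1 : ∀ᵐ a ∂μ, w a ≠ ∞) :
    (∫⁻ a, f a * g a ∂μ) ^ 2 ≤ (∫⁻ a, f a ^ 2 * w a ∂μ) * ∫⁻ a, g a ^ 2 * (w a)⁻¹ ∂μ := by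
  have h := ENNReal.lintegral_mul_le_Lp_mul_Lq μ Real.HolderConjugate.two_two
    (hf.mul (hw.pow_const (1 / 2 : ℝ))) (hg.mul (hw.pow_const (-(1 / 2) : ℝ)))
  have hsq (x y : ℝ≥0∞) (s : ℝ) : (x * y ^ s) ^ (2 : ℝ) = x ^ 2 * y ^ (s * 2) := by
    rw [ENNReal.mul_rpow_of_nonneg _ _ zero_le_two, ← ENNReal.rpow_mul, ENNReal.rpow_two]
  have hmul : ∫⁻ a, f a * g a ∂μ =
      ∫⁻ a, f a * w a ^ (1 / 2 : ℝ) * (g a * w a ^ (-(1 / 2) : ℝ)) ∂μ := by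
    refine lintegral_congr_ae ?_
    filter_upwards [hw0, hw1] with a h0 h1
    rw [mul_mul_mul_comm, ← ENNReal.rpow_add _ _ h0 h1]
    simp
  simp only [Pi.mul_apply, hsq] at h
  rw [hmul]
  calc _ ≤ _ := pow_le_pow_left' h 2
    _ = _ := by
      rw [mul_pow, ← ENNReal.rpow_two, ← ENNReal.rpow_two, ← ENNReal.rpow_mul,
        ← ENNReal.rpow_mul]
      norm_num [ENNReal.rpow_neg_one]

/-- Weighted capacity lower bound for a `k`-dimensional set in `ℝᵏ × ℝᵐ`: if `ω > 0` a.e.,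
`K ⊆ ℝᵏ` is measurable of finite measure, `R > 0`, and `u ∈ C¹` has compact support
contained in `ℝᵏ × closedBall(0,R)` with `u(x,0) = 1` for all `x ∈ K`, then
`(m · vol_m(B(0,1)) · 𝓛ᵏ(K))² ≤ (∫ ‖∇u‖² ω) · (∫_{K × B(0,R)} ‖y‖^{2(1-m)} ω⁻¹)`,
both factors in `[0,∞]`. The squared norm of the full gradient of `u` at `(x,y)` is the
sum of the squared norms of the two partial gradients. -/
theorem statement8 (k m : ℕ) (hk : 1 ≤ k) (hm : 1 ≤ m)
    (ω : EuclideanSpace ℝ (Fin k) × EuclideanSpace ℝ (Fin m) → ℝ)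
    (hω : Measurable ω)
    (hpos : ∀ᵐ p ∂(volume :
      Measure (EuclideanSpace ℝ (Fin k) × EuclideanSpace ℝ (Fin m))), 0 < ω p)
    (K : Set (EuclideanSpace ℝ (Fin k))) (hK : MeasurableSet K) (hKfin : volume K ≠ ∞)
    (R : ℝ) (hR : 0 < R)
    (u : EuclideanSpace ℝ (Fin k) × EuclideanSpace ℝ (Fin m) → ℝ)
    (hu : ContDiff ℝ 1 u) (hsupp : HasCompactSupport u)
    (hsuppR : Function.support u ⊆
      Set.univ ×ˢ closedBall (0 : EuclideanSpace ℝ (Fin m)) R)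
    (hK1 : ∀ x ∈ K, u (x, 0) = 1) :
    ((m : ℝ≥0∞) * volume (ball (0 : EuclideanSpace ℝ (Fin m)) 1) * volume K) ^ 2 ≤
      (∫⁻ p : EuclideanSpace ℝ (Fin k) × EuclideanSpace ℝ (Fin m),
          ENNReal.ofReal
              (‖gradient (fun x' => u (x', p.2)) p.1‖ ^ 2 +
                ‖gradient (fun y' => u (p.1, y')) p.2‖ ^ 2) *
            ENNReal.ofReal (ω p)) *
        (∫⁻ p in K ×ˢ ball (0 : EuclideanSpace ℝ (Fin m)) R,
          (ENNReal.ofReal ‖p.2‖) ^ (2 * (1 - (m : ℝ))) * (ENNReal.ofReal (ω p))⁻¹) := by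
  have : Nonempty (Fin m) := ⟨⟨0, hm⟩⟩
  set G : EuclideanSpace ℝ (Fin k) × EuclideanSpace ℝ (Fin m) → ℝ≥0∞ := fun p =>
    ‖(fderiv ℝ u p).comp (ContinuousLinearMap.inr ℝ _ _)‖ₑ with hG
  set ρ : EuclideanSpace ℝ (Fin k) × EuclideanSpace ℝ (Fin m) → ℝ≥0∞ := fun p =>
    ‖p.2‖ₑ ^ (1 - (m : ℝ)) with hρ
  have hGm : Measurable G :=
    ((hu.continuous_fderiv one_ne_zero).clm_comp continuous_const).enorm.measurable
  have hρm : Measurable ρ := by fun_prop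
  have hslice (x : EuclideanSpace ℝ (Fin k)) (y : EuclideanSpace ℝ (Fin m)) :
      fderiv ℝ (fun y' => u (x, y')) y =
        (fderiv ℝ u (x, y)).comp (ContinuousLinearMap.inr ℝ _ _) :=
    ((hu.differentiable one_ne_zero (x, y)).hasFDerivAt.comp y
      (hasFDerivAt_prodMk_right x y)).fderiv
  have hfiber : ∀ x ∈ K, (m : ℝ≥0∞) * volume (ball (0 : EuclideanSpace ℝ (Fin m)) 1) ≤
      ∫⁻ y in ball (0 : EuclideanSpace ℝ (Fin m)) R, G (x, y) * ρ (x, y) := by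
    intro x hx
    have h := measure_ball_mul_enorm_apply_zero_le
      (volume : Measure (EuclideanSpace ℝ (Fin m))) (v := fun y => u (x, y))
      (hu.comp (by fun_prop)) hR fun y hy => (hsuppR (a := (x, y)) hy).2
    simpa [hK1 x hx, hslice, finrank_euclideanSpace_fin, hG, hρ] using h
  have hlower : (m : ℝ≥0∞) * volume (ball (0 : EuclideanSpace ℝ (Fin m)) 1) * volume K ≤
      ∫⁻ p in K ×ˢ ball (0 : EuclideanSpace ℝ (Fin m)) R, G p * ρ p := by
    rw [Measure.volume_eq_prod,
      setLIntegral_prod (fun p => G p * ρ p) (hGm.mul hρm).aemeasurable,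
      ← setLIntegral_const]
    exact setLIntegral_mono' hK hfiber
  have hposK := ae_restrict_of_ae (s := K ×ˢ ball (0 : EuclideanSpace ℝ (Fin m)) R) hpos
  refine (pow_le_pow_left' hlower 2).trans ((sq_lintegral_mul_le_weighted _
    hGm.aemeasurable hρm.aemeasurable hω.ennreal_ofReal.aemeasurable
    (hposK.mono fun p hp => by simpa using hp) (by simp)).trans ?_)
  gcongr ?_ * ?_
  · refine (setLIntegral_le_lintegral _ _).trans (lintegral_mono fun p => ?_)
    gcongr
    have hgrad : ‖gradient (fun y' => u (p.1, y')) p.2‖ =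
        ‖(fderiv ℝ u p).comp (ContinuousLinearMap.inr ℝ _ _)‖ := by
      rw [gradient, LinearIsometryEquiv.norm_map, hslice]
    simp only [hG]
    rw [hgrad, ← ofReal_norm, ← ENNReal.ofReal_pow (norm_nonneg _)]
    exact ENNReal.ofReal_le_ofReal (le_add_of_nonneg_left (sq_nonneg _))
  · refine lintegral_mono fun p => le_of_eq ?_
    simp only [hρ]
    rw [ofReal_norm, ← ENNReal.rpow_two, ← ENNReal.rpow_mul, mul_comm (2 : ℝ)]
end

section
/- Let n ≥ 1, let c ≥ 1, and let φ : ℝⁿ → ℝⁿ be a bijection such that both φ and φ⁻¹ are Lipschitz with constant c. Let ω : ℝⁿ → ℝ be a measurable function, positive almost everywhere, satisfying the A₂ condition with constant C. Then there exists a constant C', depending only on n, c and C, such that the composition ω ∘ φ satisfies the A₂ condition with constant C'. -/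
open MeasureTheory Metric NNReal ENNReal

/-- Preimages under a `c`-antilipschitz self-map of `ℝⁿ` have volume at most `cⁿ` times larger. -/
theorem AntilipschitzWith.volume_preimage_le {n : ℕ} {c : ℝ≥0}
    {φ : EuclideanSpace ℝ (Fin n) → EuclideanSpace ℝ (Fin n)} (hφ : AntilipschitzWith c φ)
    (s : Set (EuclideanSpace ℝ (Fin n))) :
    volume (φ ⁻¹' s) ≤ (c : ℝ≥0∞) ^ n * volume s := by
  have hfin : Module.finrank ℝ (EuclideanSpace ℝ (Fin n)) = n := by simp
  have hH : (Measure.hausdorffMeasure (n : ℝ) : Measure (EuclideanSpace ℝ (Fin n))).IsAddHaarMeasure := by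
    have := isAddHaarMeasure_hausdorffMeasure (E := EuclideanSpace ℝ (Fin n))
    rwa [hfin] at this
  have hv := Measure.isAddLeftInvariant_eq_smul
    (volume : Measure (EuclideanSpace ℝ (Fin n))) (Measure.hausdorffMeasure (n : ℝ))
  rw [hv]
  simp only [Measure.smul_apply, ENNReal.smul_def, smul_eq_mul]
  rw [mul_left_comm]
  gcongr
  simpa using hφ.hausdorffMeasure_preimage_le (d := (n : ℝ)) n.cast_nonneg s

/-- Change of variables inequality on balls for a bi-Lipschitz map of `ℝⁿ`. -/
theorem LipschitzWith.setLIntegral_ball_comp_le {n : ℕ} {c : ℝ≥0} (hc : 0 < c)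
    {φ : EuclideanSpace ℝ (Fin n) → EuclideanSpace ℝ (Fin n)} (hφ : LipschitzWith c φ)
    (hφ' : AntilipschitzWith c φ) {f : EuclideanSpace ℝ (Fin n) → ℝ≥0∞} (hf : Measurable f)
    (x : EuclideanSpace ℝ (Fin n)) (r : ℝ) :
    ∫⁻ y in ball x r, f (φ y) ≤ (c : ℝ≥0∞) ^ n * ∫⁻ y in ball (φ x) (c * r), f y := by
  have hm : Measurable φ := hφ.continuous.measurable
  have hle : Measure.map φ volume ≤ (c : ℝ≥0∞) ^ n • volume :=
    Measure.le_iff.2 fun s hs => by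
      rw [Measure.map_apply hm hs]
      exact hφ'.volume_preimage_le s
  calc ∫⁻ y in ball x r, f (φ y)
      ≤ ∫⁻ y in φ ⁻¹' ball (φ x) (c * r), f (φ y) :=
        lintegral_mono_set (hφ.mapsTo_ball hc.ne' x r)
    _ = ∫⁻ y in ball (φ x) (c * r), f y ∂(Measure.map φ volume) :=
        (setLIntegral_map measurableSet_ball hf hm).symm
    _ ≤ ∫⁻ y in ball (φ x) (c * r), f y ∂((c : ℝ≥0∞) ^ n • volume) :=
        lintegral_mono' (Measure.restrict_mono le_rfl hle) le_rfl
    _ = (c : ℝ≥0∞) ^ n * ∫⁻ y in ball (φ x) (c * r), f y := by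
        rw [Measure.restrict_smul, lintegral_smul_measure, smul_eq_mul]

/-- The `A₂` property transfers through bi-Lipschitz changes of variables: there is a
constant `C'`, depending only on `n`, `c` and `C`, such that for every bijection `φ` of
`ℝⁿ` with `φ` and `φ⁻¹` Lipschitz with constant `c` and every `A₂` weight `ω` with
constant `C`, the composition `ω ∘ φ` satisfies the `A₂` condition with constant `C'`. -/
theorem statement14 (n : ℕ) (hn : 1 ≤ n) (c : ℝ≥0) (hc : 1 ≤ c) (C : ℝ≥0) :
    ∃ C' : ℝ≥0,
      ∀ φ : EuclideanSpace ℝ (Fin n) → EuclideanSpace ℝ (Fin n),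
        Function.Bijective φ → LipschitzWith c φ → AntilipschitzWith c φ →
        ∀ ω : EuclideanSpace ℝ (Fin n) → ℝ, Measurable ω →
          (∀ᵐ x ∂(volume : Measure (EuclideanSpace ℝ (Fin n))), 0 < ω x) →
          IsA2 n ω (C : ℝ≥0∞) → IsA2 n (ω ∘ φ) (C' : ℝ≥0∞) := by
  have hc0 : 0 < c := zero_lt_one.trans_le hc
  refine ⟨c ^ n * c ^ n * (C * (c ^ n) ^ 2), fun φ _ hφ hφ' ω hω _ hA x r hr => ?_⟩
  have hcr : 0 < (c : ℝ) * r := mul_pos hc0 hr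
  have hvol : volume (ball (φ x) (c * r)) = (c : ℝ≥0∞) ^ n * volume (ball x r) := by
    rw [Measure.addHaar_ball_mul_of_pos volume (φ x) (NNReal.coe_pos.2 hc0), ← Measure.addHaar_ball_center volume x r]
    simp [ENNReal.ofReal_pow]
  calc _ ≤ ((c : ℝ≥0∞) ^ n * ∫⁻ y in ball (φ x) (c * r), ENNReal.ofReal (ω y)) *
        ((c : ℝ≥0∞) ^ n * ∫⁻ y in ball (φ x) (c * r), ENNReal.ofReal (ω y)⁻¹) :=
        mul_le_mul' (hφ.setLIntegral_ball_comp_le hc0 hφ' hω.ennreal_ofReal x r)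
          (hφ.setLIntegral_ball_comp_le hc0 hφ' hω.inv.ennreal_ofReal x r)
    _ = (c : ℝ≥0∞) ^ n * (c : ℝ≥0∞) ^ n *
        ((∫⁻ y in ball (φ x) (c * r), ENNReal.ofReal (ω y)) *
          ∫⁻ y in ball (φ x) (c * r), ENNReal.ofReal (ω y)⁻¹) := by ring
    _ ≤ (c : ℝ≥0∞) ^ n * (c : ℝ≥0∞) ^ n * (C * volume (ball (φ x) (c * r)) ^ 2) := by
        refine mul_le_mul_right ?_ _
        exact hA (φ x) (c * r) hcr
    _ = _ := by
        rw [hvol]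
        push_cast
        ring
end
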